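/- Let n ≥ 2. There exists C > 0 depending only on n such that for every u ∈ C₀^∞(ℝⁿ \ {0}) and every m ∈ {j + 1/2 : j ∈ ℕ}, Σ_{|α| ≤ 2} m^{2-2|α|} ∫ |x|^{-2m+2|α|-n} |D^α u|² dx ≤ C ∫ |x|^{-2m+4-n} |Δu|² dx. -/

import Mathlib

open MeasureTheory

namespace Carl

abbrev EE (n : ℕ) := EuclideanSpace ℝ (Fin n)

noncomputable section

def pd {n : ℕ} (i : Fin n) (F : EE n → ℝ) : EE n → ℝ :=
  fun x => fderiv ℝ F x (EuclideanSpace.single i 1)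

def eul {n : ℕ} (F : EE n → ℝ) : EE n → ℝ := fun x => ∑ i, x i * pd i F x

def rot {n : ℕ} (i j : Fin n) (F : EE n → ℝ) : EE n → ℝ :=
  fun x => x i * pd j F x - x j * pd i F x

def lap {n : ℕ} (F : EE n → ℝ) : EE n → ℝ := fun x => ∑ i, pd i (pd i F) x

def sph {n : ℕ} (F : EE n → ℝ) : EE n → ℝ :=
  fun x => (1 / 2) * ∑ i, ∑ j, rot i j (rot i j F) x

abbrev Sm {n : ℕ} (F : EE n → ℝ) : Prop := ContDiff ℝ (⊤ : ℕ∞) F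

variable {n : ℕ}

theorem sm_coord (i : Fin n) : Sm (fun x : EE n => x i) := by
  unfold Sm; fun_prop

theorem Sm.diff {F : EE n → ℝ} (h : Sm F) : Differentiable ℝ F :=
  h.differentiable (by simp)

theorem Sm.pd {F : EE n → ℝ} (h : Sm F) (i : Fin n) : Sm (pd i F) := by
  unfold Carl.pd Sm
  exact (h.fderiv_right (m := (⊤ : ℕ∞)) (by simp)).clm_apply contDiff_const

theorem Sm.cont {F : EE n → ℝ} (h : Sm F) : Continuous F := h.diff.continuous

theorem Sm.add {F G : EE n → ℝ} (h : Sm F) (hg : Sm G) : Sm (fun x => F x + G x) :=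
  ContDiff.add h hg
theorem Sm.sub {F G : EE n → ℝ} (h : Sm F) (hg : Sm G) : Sm (fun x => F x - G x) :=
  ContDiff.sub h hg
theorem Sm.mul {F G : EE n → ℝ} (h : Sm F) (hg : Sm G) : Sm (fun x => F x * G x) :=
  ContDiff.mul h hg
theorem Sm.sum {ι : Type*} {s : Finset ι} {F : ι → EE n → ℝ} (h : ∀ i, Sm (F i)) :
    Sm (fun x => ∑ i ∈ s, F i x) :=
  ContDiff.sum fun i _ => h i
theorem sm_const (c : ℝ) : Sm (fun _ : EE n => c) := contDiff_const

theorem Sm.eul {F : EE n → ℝ} (h : Sm F) : Sm (eul F) :=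
  Sm.sum fun i => (sm_coord i).mul (h.pd i)
theorem Sm.lap {F : EE n → ℝ} (h : Sm F) : Sm (lap F) :=
  Sm.sum fun i => ((h.pd i).pd i)
theorem Sm.rot {F : EE n → ℝ} (h : Sm F) (i j : Fin n) : Sm (rot i j F) :=
  ((sm_coord i).mul (h.pd j)).sub ((sm_coord j).mul (h.pd i))
theorem Sm.sph {F : EE n → ℝ} (h : Sm F) : Sm (sph F) :=
  (sm_const _).mul (Sm.sum fun i => Sm.sum fun j => (h.rot i j).rot i j)

theorem pd_add {F G : EE n → ℝ} (h : Sm F) (hg : Sm G) (i : Fin n) (x) :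
    pd i (fun x => F x + G x) x = pd i F x + pd i G x := by
  simp only [pd]; rw [fderiv_fun_add (h.diff x) (hg.diff x)]; rfl
theorem pd_sub {F G : EE n → ℝ} (h : Sm F) (hg : Sm G) (i : Fin n) (x) :
    pd i (fun x => F x - G x) x = pd i F x - pd i G x := by
  simp only [pd]; rw [fderiv_fun_sub (h.diff x) (hg.diff x)]; rfl
theorem pd_mul {F G : EE n → ℝ} (h : Sm F) (hg : Sm G) (i : Fin n) (x) :
    pd i (fun x => F x * G x) x = F x * pd i G x + G x * pd i F x := by
  simp only [pd]; rw [fderiv_fun_mul (h.diff x) (hg.diff x)]; simp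
theorem pd_const (c : ℝ) (i : Fin n) (x) : pd i (fun _ => c) x = 0 := by
  simp [pd]
theorem pd_coord (i j : Fin n) (x) : pd i (fun x => x j) x = if i = j then 1 else 0 := by
  have : (fun x : EE n => x j) = EuclideanSpace.proj (𝕜 := ℝ) j := by ext; simp
  simp only [pd]; rw [this, ContinuousLinearMap.fderiv]
  simp [eq_comm]
theorem pd_cmul {F : EE n → ℝ} (h : Sm F) (c : ℝ) (i : Fin n) (x) :
    pd i (fun x => c * F x) x = c * pd i F x := by
  rw [pd_mul (sm_const c) h, pd_const]; simp
theorem pd_sum {ι : Type*} {s : Finset ι} {F : ι → EE n → ℝ} (h : ∀ i, Sm (F i)) (i : Fin n) (x) :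
    pd i (fun x => ∑ j ∈ s, F j x) x = ∑ j ∈ s, pd i (F j) x := by
  simp only [pd]; rw [fderiv_fun_sum (fun j _ => (h j).diff x)]; simp

theorem pd_comm {F : EE n → ℝ} (h : Sm F) (i j : Fin n) (x) :
    pd i (pd j F) x = pd j (pd i F) x := by
  have hd : DifferentiableAt ℝ (fderiv ℝ F) x :=
    ((h.fderiv_right (m := (⊤ : ℕ∞)) (by simp)).differentiable (by simp)) x
  have key : ∀ i j : Fin n, pd i (pd j F) x
      = fderiv ℝ (fderiv ℝ F) x (EuclideanSpace.single i 1) (EuclideanSpace.single j 1) := by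
    intro i j
    have : pd j F = fun x => fderiv ℝ F x (EuclideanSpace.single j 1) := rfl
    rw [pd, this, fderiv_clm_apply hd (differentiableAt_const _)]
    simp
  rw [key, key]
  have := (h.contDiffAt (x := x)).isSymmSndFDerivAt (by
    simp only [minSmoothness_of_isRCLikeNormedField]; exact WithTop.coe_le_coe.2 (le_top : (2 : ℕ∞) ≤ ⊤))
  exact this _ _

theorem fderiv_eq_sum (F : EE n → ℝ) (x v : EE n) :
    fderiv ℝ F x v = ∑ i, v i * pd i F x := by
  conv_lhs => rw [← (EuclideanSpace.basisFun (Fin n) ℝ).sum_repr v]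
  simp [pd]

theorem norm_sq_sum (x : EE n) : ‖x‖ ^ 2 = ∑ i, x i ^ 2 := by
  rw [EuclideanSpace.norm_sq_eq]; simp

theorem rot_rot {F : EE n → ℝ} (h : Sm F) (i j : Fin n) (x) :
    rot i j (rot i j F) x =
      x i * ((if i = j then 1 else 0) * pd j F x + x i * pd j (pd j F) x
        - pd i F x - x j * pd i (pd j F) x)
      - x j * (pd j F x + x i * pd i (pd j F) x - (if i = j then 1 else 0) * pd i F x
        - x j * pd i (pd i F) x) := by
  have e : rot i j F = fun x => x i * pd j F x - x j * pd i F x := rfl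
  have e1 : ∀ k, pd k (rot i j F) x = ((if k = i then 1 else 0) * pd j F x + x i * pd k (pd j F) x)
      - ((if k = j then 1 else 0) * pd i F x + x j * pd k (pd i F) x) := by
    intro k
    rw [e, pd_sub ((sm_coord i).mul (h.pd j)) ((sm_coord j).mul (h.pd i)),
      pd_mul (sm_coord i) (h.pd j), pd_mul (sm_coord j) (h.pd i), pd_coord, pd_coord]
    ring
  rw [rot, e1, e1, pd_comm h j i]
  by_cases hij : i = j
  · subst hij; simp
  · have : ¬ j = i := fun h => hij h.symm
    simp only [if_neg hij, if_neg this, if_true]; ring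

theorem eul_eul {F : EE n → ℝ} (h : Sm F) (x) :
    eul (eul F) x = eul F x + ∑ i, ∑ j, x i * x j * pd i (pd j F) x := by
  have e : ∀ i, pd i (eul F) x = pd i F x + ∑ j, x j * pd i (pd j F) x := by
    intro i
    have : eul F = fun x => ∑ j, x j * pd j F x := rfl
    rw [this, pd_sum (fun j => (sm_coord j).mul (h.pd j))]
    simp_rw [pd_mul (sm_coord _) (h.pd _), pd_coord]
    rw [Finset.sum_add_distrib]
    simp [add_comm]
  rw [eul]
  simp_rw [e, mul_add, Finset.sum_add_distrib, Finset.mul_sum, mul_assoc]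
  rfl

theorem sph_eq {F : EE n → ℝ} (h : Sm F) (x) :
    sph F x = ‖x‖ ^ 2 * lap F x - eul (eul F) x - (n - 2) * eul F x := by
  rw [eul_eul h, sph, norm_sq_sum]
  set H := ∑ i, ∑ j, x i * x j * pd i (pd j F) x with hH
  simp_rw [rot_rot h]
  have A : ∑ i, ∑ j, x i * ((if i = j then (1:ℝ) else 0) * pd j F x) = eul F x := by
    simp [eul]
  have A' : ∑ i, ∑ j, x j * ((if i = j then (1:ℝ) else 0) * pd i F x) = eul F x := by
    simp [eul]
  have B : ∑ i, ∑ j, x i ^ 2 * pd j (pd j F) x = (∑ i, x i ^ 2) * lap F x := by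
    rw [lap, Finset.sum_mul_sum]
  have B' : ∑ i, ∑ j, x j ^ 2 * pd i (pd i F) x = (∑ i, x i ^ 2) * lap F x := by
    rw [Finset.sum_comm, B]
  have D : ∑ i : Fin n, ∑ j : Fin n, x i * pd i F x = n * eul F x := by
    simp [eul, Finset.mul_sum]
  have D' : ∑ i : Fin n, ∑ j : Fin n, x j * pd j F x = n * eul F x := by
    simp [eul]
  have : ∑ i, ∑ j, (x i * ((if i = j then 1 else 0) * pd j F x + x i * pd j (pd j F) x
        - pd i F x - x j * pd i (pd j F) x)
      - x j * (pd j F x + x i * pd i (pd j F) x - (if i = j then 1 else 0) * pd i F x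
        - x j * pd i (pd i F) x)) =
      ∑ i, ∑ j, x i * ((if i = j then (1:ℝ) else 0) * pd j F x)
      + ∑ i, ∑ j, x j * ((if i = j then (1:ℝ) else 0) * pd i F x)
      + ∑ i, ∑ j, x i ^ 2 * pd j (pd j F) x + ∑ i, ∑ j, x j ^ 2 * pd i (pd i F) x
      - ∑ i : Fin n, ∑ j : Fin n, x i * pd i F x - ∑ i : Fin n, ∑ j : Fin n, x j * pd j F x
      - 2 * ∑ i, ∑ j, x i * x j * pd i (pd j F) x := by
    simp_rw [Finset.mul_sum, ← Finset.sum_add_distrib, ← Finset.sum_sub_distrib]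
    refine Finset.sum_congr rfl fun i _ => Finset.sum_congr rfl fun j _ => ?_
    ring
  rw [this, A, A', B, B', D, D', ← hH]
  ring

end
end Carl

namespace Carl
noncomputable section
variable {n : ℕ}

structure TF (u : EE n → ℝ) : Prop where
  sm : Sm u
  cs : HasCompactSupport u
  z : (0 : EE n) ∉ tsupport u

theorem TF.ev {u : EE n → ℝ} (h : TF u) : ∀ᶠ x in nhds (0 : EE n), u x = 0 :=
  notMem_tsupport_iff_eventuallyEq.1 h.z

theorem TF.zero {u : EE n → ℝ} (h : TF u) : u 0 = 0 := h.ev.self_of_nhds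

theorem TF.of_subset {u v : EE n → ℝ} (h : TF u) (hv : Sm v) (hs : tsupport v ⊆ tsupport u) :
    TF v := ⟨hv, h.cs.of_isClosed_subset (isClosed_tsupport _) hs, fun h0 => h.z (hs h0)⟩

theorem TF.mul {F u : EE n → ℝ} (hF : Sm F) (h : TF u) : TF (fun x => F x * u x) :=
  h.of_subset (hF.mul h.sm) (tsupport_mul_subset_right)

theorem TF.mul_right {F u : EE n → ℝ} (h : TF u) (hF : Sm F) : TF (fun x => u x * F x) :=
  h.of_subset (h.sm.mul hF) (tsupport_mul_subset_left)

theorem TF.add {u v : EE n → ℝ} (h : TF u) (hv : TF v) : TF (fun x => u x + v x) := by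
  refine ⟨h.sm.add hv.sm, h.cs.add hv.cs, fun h0 => ?_⟩
  rcases tsupport_add u v h0 with h1 | h1
  exacts [h.z h1, hv.z h1]

theorem TF.pd {u : EE n → ℝ} (h : TF u) (i : Fin n) : TF (pd i u) :=
  h.of_subset (h.sm.pd i) (by
    refine (closure_mono ?_).trans (tsupport_fderiv_subset ℝ (f := u))
    intro x hx
    rw [Function.mem_support] at hx ⊢
    intro h0; apply hx; simp [Carl.pd, h0])

theorem tf_zero : TF (fun _ : EE n => (0:ℝ)) := by
  refine ⟨sm_const 0, HasCompactSupport.zero, ?_⟩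
  have : tsupport (fun _ : EE n => (0:ℝ)) = ∅ := tsupport_eq_empty_iff.2 rfl
  rw [this]; simp

theorem TF.sum {ι : Type*} {s : Finset ι} {F : ι → EE n → ℝ} (h : ∀ i, TF (F i)) :
    TF (fun x => ∑ i ∈ s, F i x) := by
  classical
  induction s using Finset.induction_on with
  | empty => simpa using tf_zero
  | insert a s ha ih => simp_rw [Finset.sum_insert ha]; exact (h a).add ih

theorem TF.eul {u : EE n → ℝ} (h : TF u) : TF (eul u) := TF.sum fun i => TF.mul (sm_coord i) (h.pd i)
theorem TF.lap {u : EE n → ℝ} (h : TF u) : TF (lap u) := TF.sum fun i => (h.pd i).pd i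

theorem TF.rpow {u : EE n → ℝ} (h : TF u) (s : ℝ) : TF (fun x => ‖x‖ ^ s * u x) := by
  refine h.of_subset ?_ tsupport_mul_subset_right
  refine contDiff_iff_contDiffAt.2 fun x => ?_
  by_cases hx : x = 0
  · subst hx
    have : (fun x : EE n => ‖x‖ ^ s * u x) =ᶠ[nhds 0] fun _ => 0 := by
      filter_upwards [h.ev] with x hx; simp [hx]
    exact contDiffAt_const.congr_of_eventuallyEq this
  · exact ((contDiffAt_norm ℝ hx).rpow_const_of_ne (norm_ne_zero_iff.2 hx)).mul h.sm.contDiffAt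

theorem TF.integrable {u : EE n → ℝ} (h : TF u) : Integrable u :=
  h.sm.cont.integrable_of_hasCompactSupport h.cs

theorem pd_rpow {u : EE n → ℝ} (h : TF u) (s : ℝ) (i : Fin n) (x) :
    pd i (fun x => ‖x‖ ^ s * u x) x
      = ‖x‖ ^ s * pd i u x + s * ‖x‖ ^ (s - 2) * x i * u x := by
  by_cases hx : x = 0
  · subst hx
    rw [(h.rpow s).pd i |>.zero, (h.pd i).zero, h.zero]; simp
  · have hpos : 0 < ‖x‖ := norm_pos_iff.2 hx
    have h2 : HasFDerivAt (fun x : EE n => (‖x‖ ^ 2) ^ (s / 2)) _ x :=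
      ((hasStrictFDerivAt_norm_sq x).hasFDerivAt).rpow_const (p := s / 2) (Or.inl (by positivity))
    have e : (fun x : EE n => (‖x‖ ^ 2) ^ (s / 2)) = fun x => ‖x‖ ^ s := by
      ext y; rw [← Real.rpow_natCast, ← Real.rpow_mul (norm_nonneg _)]; congr 1; push_cast; ring
    rw [e] at h2
    have h3 := h2.fun_mul (h.sm.diff x).hasFDerivAt
    simp only [pd]
    rw [h3.fderiv]
    have e2 : (‖x‖ ^ 2) ^ (s / 2 - 1) = ‖x‖ ^ (s - 2) := by
      rw [← Real.rpow_natCast, ← Real.rpow_mul (norm_nonneg _)]; congr 1; push_cast; ring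
    simp [e2, EuclideanSpace.inner_single_right]
    ring

theorem ibp {F g : EE n → ℝ} (hF : TF F) (hg : Sm g) (i : Fin n) :
    ∫ x, F x * pd i g x = - ∫ x, pd i F x * g x := by
  apply integral_mul_fderiv_eq_neg_fderiv_mul_of_integrable
  · exact ((hF.pd i).mul_right hg).integrable
  · exact (hF.mul_right (hg.pd i)).integrable
  · exact (hF.mul_right hg).integrable
  · exact fun x _ => hF.sm.diff x
  · exact fun x _ => hg.diff x

theorem rpow_sub_sq {x : EE n} (hx : x ≠ 0) (s : ℝ) : ‖x‖ ^ (s - 2) * ‖x‖ ^ 2 = ‖x‖ ^ s := by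
  have hpos : 0 < ‖x‖ := norm_pos_iff.2 hx
  rw [← Real.rpow_natCast, ← Real.rpow_add hpos]; congr 1; push_cast; ring

/-- the radial cross term -/
theorem cross_term {u : EE n → ℝ} (h : TF u) (s : ℝ) :
    2 * ∫ x, ‖x‖ ^ s * (eul u x * u x) = -(n + s) * ∫ x, ‖x‖ ^ s * u x ^ 2 := by
  have h1 : ∀ i : Fin n, ∫ x, (‖x‖ ^ s * (x i * u x)) * pd i u x =
      - ∫ x, (‖x‖ ^ s * (u x ^ 2) + ‖x‖ ^ s * (x i * pd i u x * u x)
        + s * (‖x‖ ^ (s - 2) * (x i ^ 2 * u x ^ 2))) := by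
    intro i
    rw [ibp ((TF.mul (sm_coord i) h).rpow s) h.sm i]
    congr 2; ext x
    rw [pd_rpow (TF.mul (sm_coord i) h), pd_mul (sm_coord i) h.sm, pd_coord]
    simp only [if_true]; ring
  have h2 : ∫ x, ‖x‖ ^ s * (eul u x * u x) = ∑ i, ∫ x, (‖x‖ ^ s * (x i * u x)) * pd i u x := by
    rw [← integral_finsetSum]
    · congr 1; ext x; simp only [eul, Finset.mul_sum, Finset.sum_mul]
      exact Finset.sum_congr rfl fun i _ => by ring
    · exact fun i _ => (((TF.mul (sm_coord i) h).rpow s).mul_right (h.sm.pd i)).integrable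
  have i1 : Integrable fun x => ‖x‖ ^ s * u x ^ 2 := by
    simpa only [pow_two] using ((h.mul_right h.sm).rpow s).integrable
  have i2 : ∀ i, Integrable fun x => ‖x‖ ^ s * (x i * pd i u x * u x) := fun i =>
    ((TF.mul ((sm_coord i).mul (h.sm.pd i)) h).rpow s).integrable
  have i3 : ∀ i : Fin n, Integrable fun x : EE n => s * (‖x‖ ^ (s - 2) * (x i ^ 2 * u x ^ 2)) := fun i => by
    have := ((TF.mul ((sm_coord i).mul (sm_coord i)) (h.mul_right h.sm)).rpow (s-2)).integrable.const_mul s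
    simpa only [pow_two] using this
  have h3 : ∑ i, ∫ x, (‖x‖ ^ s * (u x ^ 2) + ‖x‖ ^ s * (x i * pd i u x * u x)
        + s * (‖x‖ ^ (s - 2) * (x i ^ 2 * u x ^ 2))) =
      (n + s) * (∫ x, ‖x‖ ^ s * u x ^ 2) + ∫ x, ‖x‖ ^ s * (eul u x * u x) := by
    rw [← integral_finsetSum _ (fun i _ => (i1.fun_add (i2 i)).fun_add (i3 i)), ← integral_const_mul, ← integral_add]
    · congr 1; ext x
      rw [Finset.sum_add_distrib, Finset.sum_add_distrib]
      have e1 : ∑ i, ‖x‖ ^ s * (x i * pd i u x * u x) = ‖x‖ ^ s * (eul u x * u x) := by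
        simp only [eul, Finset.mul_sum, Finset.sum_mul]
      have e2 : ∑ i : Fin n, s * (‖x‖ ^ (s - 2) * (x i ^ 2 * u x ^ 2)) = s * (‖x‖ ^ s * u x ^ 2) := by
        rw [← Finset.mul_sum, ← Finset.mul_sum, ← Finset.sum_mul, ← norm_sq_sum]
        by_cases hx : x = 0
        · subst hx; simp [h.zero]
        · rw [← rpow_sub_sq hx s]; ring
      rw [e1, e2]; simp; ring
    · exact i1.const_mul _
    · exact ((h.eul.mul_right h.sm).rpow s).integrable
  have h4 : ∫ x, ‖x‖ ^ s * (eul u x * u x) = -((n + s) * (∫ x, ‖x‖ ^ s * u x ^ 2) + ∫ x, ‖x‖ ^ s * (eul u x * u x)) := by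
    rw [← h3, ← Finset.sum_neg_distrib]
    rw [h2]
    exact Finset.sum_congr rfl fun i _ => h1 i
  linarith

theorem grad_identity {u : EE n → ℝ} (h : TF u) (s : ℝ) :
    ∫ x, ‖x‖ ^ s * ∑ i, pd i u x ^ 2 =
      - (∫ x, ‖x‖ ^ s * (u x * lap u x)) + s * (s + n - 2) / 2 * ∫ x, ‖x‖ ^ (s - 2) * u x ^ 2 := by
  have c := cross_term h (s - 2)
  have h1 : ∀ i : Fin n, ∫ x, (‖x‖ ^ s * pd i u x) * pd i u x =
      - ∫ x, (‖x‖ ^ s * (u x * pd i (pd i u) x) + s * (‖x‖ ^ (s - 2) * (x i * pd i u x * u x))) := by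
    intro i
    rw [ibp ((h.pd i).rpow s) h.sm i]
    congr 2; ext x
    rw [pd_rpow (h.pd i)]; ring
  have i1 : ∀ i : Fin n, Integrable fun x => (‖x‖ ^ s * pd i u x) * pd i u x := fun i =>
    (((h.pd i).rpow s).mul_right (h.sm.pd i)).integrable
  have i2 : ∀ i : Fin n, Integrable fun x => ‖x‖ ^ s * (u x * pd i (pd i u) x) := fun i =>
    ((h.mul_right ((h.sm.pd i).pd i)).rpow s).integrable
  have i3 : ∀ i : Fin n, Integrable fun x => s * (‖x‖ ^ (s - 2) * (x i * pd i u x * u x)) := fun i =>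
    (((TF.mul ((sm_coord i).mul (h.sm.pd i)) h).rpow (s-2)).integrable).const_mul s
  have h2 : ∫ x, ‖x‖ ^ s * ∑ i, pd i u x ^ 2 = ∑ i, ∫ x, (‖x‖ ^ s * pd i u x) * pd i u x := by
    rw [← integral_finsetSum _ (fun i _ => i1 i)]
    congr 1; ext x; rw [Finset.mul_sum]
    exact Finset.sum_congr rfl fun i _ => by ring
  have h3 : ∑ i : Fin n, ∫ x, (‖x‖ ^ s * (u x * pd i (pd i u) x) + s * (‖x‖ ^ (s - 2) * (x i * pd i u x * u x)))
      = (∫ x, ‖x‖ ^ s * (u x * lap u x)) + s * ∫ x, ‖x‖ ^ (s - 2) * (eul u x * u x) := by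
    rw [← integral_finsetSum _ (fun i _ => (i2 i).fun_add (i3 i)), ← integral_const_mul, ← integral_add]
    · congr 1; ext x
      rw [Finset.sum_add_distrib]
      simp only [lap, eul, Finset.mul_sum, Finset.sum_mul]
    · exact ((h.mul_right h.sm.lap).rpow s).integrable
    · exact ((h.eul.mul_right h.sm).rpow _).integrable.const_mul s
  rw [h2, Finset.sum_congr rfl fun i _ => h1 i, Finset.sum_neg_distrib, h3]
  have : ∫ x, ‖x‖ ^ (s - 2) * (eul u x * u x) = -(n + (s-2)) / 2 * ∫ x, ‖x‖ ^ (s - 2) * u x ^ 2 := by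
    linarith
  rw [this]; ring

theorem lap_pd {u : EE n → ℝ} (h : Sm u) (i : Fin n) (x) : lap (pd i u) x = pd i (lap u) x := by
  have e : lap u = fun x => ∑ j, pd j (pd j u) x := rfl
  rw [e, pd_sum (fun j => (h.pd j).pd j), lap]
  refine Finset.sum_congr rfl fun j _ => ?_
  have : pd j (pd i u) = pd i (pd j u) := by ext y; exact pd_comm h j i y
  rw [this, pd_comm (h.pd j)]

theorem hess_identity {u : EE n → ℝ} (h : TF u) (s : ℝ) :
    ∫ x, ‖x‖ ^ s * ∑ i, ∑ j, pd j (pd i u) x ^ 2 =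
      (∫ x, ‖x‖ ^ s * lap u x ^ 2) + s * (∫ x, ‖x‖ ^ (s - 2) * (eul u x * lap u x))
      + s * (s + n - 2) / 2 * ∫ x, ‖x‖ ^ (s - 2) * ∑ i, pd i u x ^ 2 := by
  have i0 : ∀ i : Fin n, Integrable fun x => ‖x‖ ^ s * ∑ j, pd j (pd i u) x ^ 2 := fun i => by
    simpa only [pow_two] using ((TF.sum fun j => ((h.pd i).pd j).mul_right ((h.sm.pd i).pd j)).rpow s).integrable
  have h2 : ∫ x, ‖x‖ ^ s * ∑ i, ∑ j, pd j (pd i u) x ^ 2 = ∑ i, ∫ x, ‖x‖ ^ s * ∑ j, pd j (pd i u) x ^ 2 := by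
    rw [← integral_finsetSum _ (fun i _ => i0 i)]
    congr 1; ext x; rw [Finset.mul_sum]
  have h1 : ∀ i : Fin n, ∫ x, ‖x‖ ^ s * (pd i u x * lap (pd i u) x) =
      - ∫ x, (‖x‖ ^ s * (pd i (pd i u) x * lap u x) + s * (‖x‖ ^ (s - 2) * (x i * pd i u x * lap u x))) := by
    intro i
    have : ∫ x, ‖x‖ ^ s * (pd i u x * lap (pd i u) x) = ∫ x, (‖x‖ ^ s * pd i u x) * pd i (lap u) x := by
      congr 1; ext x; rw [lap_pd h.sm]; ring
    rw [this, ibp ((h.pd i).rpow s) h.sm.lap i]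
    congr 2; ext x
    rw [pd_rpow (h.pd i)]; ring
  have i2 : ∀ i : Fin n, Integrable fun x => ‖x‖ ^ s * (pd i (pd i u) x * lap u x) := fun i =>
    ((((h.pd i).pd i).mul_right h.sm.lap).rpow s).integrable
  have i3 : ∀ i : Fin n, Integrable fun x => s * (‖x‖ ^ (s - 2) * (x i * pd i u x * lap u x)) := fun i =>
    (((TF.mul ((sm_coord i).mul (h.sm.pd i)) h.lap).rpow (s-2)).integrable).const_mul s
  have h3 : ∑ i : Fin n, ∫ x, (‖x‖ ^ s * (pd i (pd i u) x * lap u x) + s * (‖x‖ ^ (s - 2) * (x i * pd i u x * lap u x)))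
      = (∫ x, ‖x‖ ^ s * lap u x ^ 2) + s * ∫ x, ‖x‖ ^ (s - 2) * (eul u x * lap u x) := by
    rw [← integral_finsetSum _ (fun i _ => (i2 i).fun_add (i3 i)), ← integral_const_mul, ← integral_add]
    · congr 1; ext x
      rw [Finset.sum_add_distrib]
      have e1 : ∑ i, ‖x‖ ^ s * (pd i (pd i u) x * lap u x) = ‖x‖ ^ s * lap u x ^ 2 := by
        rw [← Finset.mul_sum, ← Finset.sum_mul, pow_two]; rfl
      have e2 : ∑ i, s * (‖x‖ ^ (s - 2) * (x i * pd i u x * lap u x)) = s * (‖x‖ ^ (s - 2) * (eul u x * lap u x)) := by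
        rw [← Finset.mul_sum, ← Finset.mul_sum, ← Finset.sum_mul]; rfl
      rw [e1, e2]
    · simpa only [pow_two] using ((h.lap.mul_right h.sm.lap).rpow s).integrable
    · exact ((h.eul.mul_right h.sm.lap).rpow _).integrable.const_mul s
  have h5 : ∑ i, ∫ x, ‖x‖ ^ (s - 2) * pd i u x ^ 2 = ∫ x, ‖x‖ ^ (s - 2) * ∑ i, pd i u x ^ 2 := by
    rw [← integral_finsetSum]
    · congr 1; ext x; rw [Finset.mul_sum]
    · intro i _
      simpa only [pow_two] using (((h.pd i).mul_right (h.sm.pd i)).rpow (s-2)).integrable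
  rw [h2, Finset.sum_congr rfl fun i _ => grad_identity (h.pd i) s, Finset.sum_add_distrib,
    ← Finset.mul_sum, h5, Finset.sum_neg_distrib, Finset.sum_congr rfl fun i _ => h1 i,
    Finset.sum_neg_distrib, h3]
  ring

end
end Carl

namespace Carl
noncomputable section
variable {n : ℕ}

theorem TF.int_sq {u : EE n → ℝ} (h : TF u) (s : ℝ) : Integrable fun x => ‖x‖ ^ s * u x ^ 2 := by
  simpa only [pow_two] using ((h.mul_right h.sm).rpow s).integrable

theorem TF.int_grad {u : EE n → ℝ} (h : TF u) (s : ℝ) :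
    Integrable fun x => ‖x‖ ^ s * ∑ i, Carl.pd i u x ^ 2 := by
  simpa only [pow_two] using ((TF.sum fun i => (h.pd i).mul_right (h.sm.pd i)).rpow s).integrable

theorem TF.int_hess {u : EE n → ℝ} (h : TF u) (s : ℝ) :
    Integrable fun x => ‖x‖ ^ s * ∑ i, ∑ j, Carl.pd j (Carl.pd i u) x ^ 2 := by
  simpa only [pow_two] using ((TF.sum fun i => TF.sum fun j =>
    ((h.pd i).pd j).mul_right ((h.sm.pd i).pd j)).rpow s).integrable

theorem eul_sq_le (u : EE n → ℝ) (x : EE n) : eul u x ^ 2 ≤ ‖x‖ ^ 2 * ∑ i, pd i u x ^ 2 := by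
  rw [norm_sq_sum]; exact Finset.sum_mul_sq_le_sq_mul_sq _ _ _

theorem rpow_add_two {x : EE n} (hx : x ≠ 0) (s t : ℝ) (k : ℕ) (h : t = s + k) :
    ‖x‖ ^ t = ‖x‖ ^ s * ‖x‖ ^ k := by
  have hpos : 0 < ‖x‖ := norm_pos_iff.2 hx
  rw [← Real.rpow_natCast, ← Real.rpow_add hpos, h]

theorem est1 {u : EE n → ℝ} (hn : 1 ≤ n) (h : TF u) (m : ℝ) (hm : 1 / 2 ≤ m)
    (h0 : m ^ 2 * ∫ x, ‖x‖ ^ (-2 * m - n) * u x ^ 2 ≤ 4 * ∫ x, ‖x‖ ^ (-2 * m + 4 - n) * lap u x ^ 2) :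
    ∫ x, ‖x‖ ^ (-2 * m + 2 - n) * ∑ i, pd i u x ^ 2
      ≤ (9 + 8 * n) * ∫ x, ‖x‖ ^ (-2 * m + 4 - n) * lap u x ^ 2 := by
  have id1 := grad_identity h (-2 * m + 2 - n)
  have e : -2 * m + 2 - n - 2 = -2 * m - n := by ring
  rw [e] at id1
  set A := ∫ x, ‖x‖ ^ (-2 * m - n) * u x ^ 2 with hA
  set B := ∫ x, ‖x‖ ^ (-2 * m + 4 - n) * lap u x ^ 2 with hB
  have hB0 : 0 ≤ B := integral_nonneg fun x => by positivity
  have hA0 : 0 ≤ A := integral_nonneg fun x => by positivity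
  have h1 : - ∫ x, ‖x‖ ^ (-2 * m + 2 - n) * (u x * lap u x) ≤ 1 / 2 * (A + B) := by
    rw [← integral_neg, hA, hB, ← integral_add (h.int_sq _) (h.lap.int_sq _), ← integral_const_mul]
    refine integral_mono ((h.mul_right h.sm.lap).rpow _).integrable.neg
      (((h.int_sq _).add (h.lap.int_sq _)).const_mul _) fun x => ?_
    by_cases hx : x = 0
    · subst hx; simp [h.zero, h.lap.zero]
    · simp only
      rw [rpow_add_two hx (-2 * m - n) (-2 * m + 2 - n) 2 (by push_cast; ring),
        rpow_add_two hx (-2 * m - n) (-2 * m + 4 - n) 4 (by push_cast; ring)]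
      have hp : 0 ≤ ‖x‖ ^ (-2 * m - n) := by positivity
      nlinarith [mul_nonneg hp (sq_nonneg (u x + ‖x‖ ^ 2 * lap u x))]
  have hn' : (1 : ℝ) ≤ n := by exact_mod_cast hn
  have c1 : (-2 * m + 2 - n) * (-2 * m + 2 - n + n - 2) / 2 ≤ 2 * n * m ^ 2 := by
    nlinarith [mul_nonneg (mul_nonneg (by linarith : 0 ≤ m) (by linarith : (0:ℝ) ≤ n - 1)) (by linarith : 0 ≤ 2 * m - 1)]
  have hm4 : 1 ≤ 4 * m ^ 2 := by nlinarith
  have c2 := mul_le_mul_of_nonneg_right c1 hA0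
  have c3 : A ≤ 4 * (m ^ 2 * A) := by linarith [mul_le_mul_of_nonneg_right hm4 hA0]
  have c4 : 2 * n * m ^ 2 * A ≤ 2 * n * (4 * B) := by
    have := mul_le_mul_of_nonneg_left h0 (by positivity : (0:ℝ) ≤ 2 * n)
    linarith
  rw [id1]
  linarith

theorem est2 {u : EE n → ℝ} (h : TF u) (m : ℝ) (hm : 1 / 2 ≤ m)
    (h1 : ∫ x, ‖x‖ ^ (-2 * m + 2 - n) * ∑ i, pd i u x ^ 2
      ≤ (9 + 8 * n) * ∫ x, ‖x‖ ^ (-2 * m + 4 - n) * lap u x ^ 2) :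
    ∫ x, ‖x‖ ^ (-2 * m + 4 - n) * ∑ i, ∑ j, pd j (pd i u) x ^ 2
      ≤ (6 + (2 * (n + 5) ^ 2 + 6 * (n + 5)) * (9 + 8 * n)) * m ^ 2 *
        ∫ x, ‖x‖ ^ (-2 * m + 4 - n) * lap u x ^ 2 := by
  have id2 := hess_identity h (-2 * m + 4 - n)
  have e : -2 * m + 4 - n - 2 = -2 * m + 2 - n := by ring
  rw [e] at id2
  set s := -2 * m + 4 - n with hs
  set A := ∫ x, ‖x‖ ^ (-2 * m + 2 - n) * ∑ i, pd i u x ^ 2 with hA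
  set B := ∫ x, ‖x‖ ^ s * lap u x ^ 2 with hB
  have hB0 : 0 ≤ B := integral_nonneg fun x => by positivity
  have hA0 : 0 ≤ A := integral_nonneg fun x => by positivity
  have h2 : s * (∫ x, ‖x‖ ^ (-2 * m + 2 - n) * (eul u x * lap u x)) ≤ 1 / 2 * (s ^ 2 * A + B) := by
    rw [hA, hB, ← integral_const_mul, ← integral_const_mul,
      ← integral_add ((h.int_grad _).const_mul _) (h.lap.int_sq _), ← integral_const_mul]
    refine integral_mono (((h.eul.mul_right h.sm.lap).rpow _).integrable.const_mul _)
      ((((h.int_grad _).const_mul _).add (h.lap.int_sq _)).const_mul _) fun x => ?_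
    by_cases hx : x = 0
    · subst hx; simp [h.eul.zero, h.lap.zero, fun i => (h.pd i).zero]
    · simp only
      rw [rpow_add_two hx (-2 * m - n) (-2 * m + 2 - n) 2 (by push_cast; ring),
        rpow_add_two hx (-2 * m - n) s 4 (by rw [hs]; push_cast; ring)]
      have hp : 0 ≤ ‖x‖ ^ (-2 * m - n) := by positivity
      have q := mul_le_mul_of_nonneg_left (eul_sq_le u x) (mul_nonneg hp (sq_nonneg s))
      nlinarith [mul_nonneg hp (sq_nonneg (s * eul u x - ‖x‖ ^ 2 * lap u x))]
  have hn' : (0 : ℝ) ≤ n := by positivity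
  have hm0 : 0 ≤ m := by linarith
  have hnm : (n:ℝ) ≤ 2 * n * m := by nlinarith
  have c0 : s ^ 2 ≤ (2 * (n + 5) * m) ^ 2 := by
    apply sq_le_sq'
    · rw [hs]; nlinarith
    · rw [hs]; nlinarith
  have c1 : s * (s + n - 2) / 2 ≤ 6 * (n + 5) * m ^ 2 := by
    have : s * (s + n - 2) / 2 = (2 * m + n - 4) * (m - 1) := by rw [hs]; ring
    rw [this]
    have q1 : (n:ℝ) * m ≤ 2 * n * m * m := by nlinarith
    nlinarith
  have c2 := mul_le_mul_of_nonneg_right c1 hA0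
  have c3 := mul_le_mul_of_nonneg_right c0 hA0
  have c4 : B ≤ 4 * (m ^ 2 * B) := by
    have hm4 : 1 ≤ 4 * m ^ 2 := by nlinarith
    linarith [mul_le_mul_of_nonneg_right hm4 hB0]
  have c5 := mul_le_mul_of_nonneg_left h1 (by positivity : (0:ℝ) ≤ (2 * (n + 5) ^ 2 + 6 * (n + 5)) * m ^ 2)
  rw [id2]
  linarith

theorem norm_iter1 (u : EE n → ℝ) (x : EE n) :
    ‖iteratedFDeriv ℝ 1 u x‖ ^ 2 ≤ ∑ i, pd i u x ^ 2 := by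
  have : ‖iteratedFDeriv ℝ 1 u x‖ ≤ √(∑ i, pd i u x ^ 2) := by
    refine ContinuousMultilinearMap.opNorm_le_bound (by positivity) fun v => ?_
    rw [iteratedFDeriv_one_apply, fderiv_eq_sum]
    refine Real.abs_le_sqrt (Finset.sum_mul_sq_le_sq_mul_sq _ _ _) |>.trans ?_
    rw [← norm_sq_sum, mul_comm, Real.sqrt_mul (by positivity), Real.sqrt_sq (norm_nonneg _)]
    simp
  calc _ ≤ √(∑ i, pd i u x ^ 2) ^ 2 := by gcongr
    _ = _ := Real.sq_sqrt (by positivity)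

theorem fderiv2_eq {u : EE n → ℝ} (h : Sm u) (x v w : EE n) :
    fderiv ℝ (fderiv ℝ u) x v w = ∑ i, ∑ j, w i * v j * pd j (pd i u) x := by
  have hd : DifferentiableAt ℝ (fderiv ℝ u) x :=
    ((h.fderiv_right (m := (⊤ : ℕ∞)) (by simp)).differentiable (by simp)) x
  have : fderiv ℝ (fderiv ℝ u) x v w = fderiv ℝ (fun y => fderiv ℝ u y w) x v := by
    rw [fderiv_clm_apply hd (differentiableAt_const _)]
    simp
  rw [this]
  have e : (fun y => fderiv ℝ u y w) = fun y => ∑ i, w i * pd i u y := by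
    ext y; exact fderiv_eq_sum u y w
  rw [e, fderiv_eq_sum]
  simp_rw [pd_sum (fun i => (sm_const (w i)).mul (h.pd i)), pd_cmul (h.pd _), Finset.mul_sum]
  rw [Finset.sum_comm]
  exact Finset.sum_congr rfl fun i _ => Finset.sum_congr rfl fun j _ => by ring

theorem norm_iter2 {u : EE n → ℝ} (h : Sm u) (x : EE n) :
    ‖iteratedFDeriv ℝ 2 u x‖ ^ 2 ≤ ∑ i, ∑ j, pd j (pd i u) x ^ 2 := by
  have : ‖iteratedFDeriv ℝ 2 u x‖ ≤ √(∑ i, ∑ j, pd j (pd i u) x ^ 2) := by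
    refine ContinuousMultilinearMap.opNorm_le_bound (by positivity) fun v => ?_
    rw [iteratedFDeriv_two_apply, fderiv2_eq h]
    rw [← Fintype.sum_prod_type' (f := fun i j => v 1 i * v 0 j * pd j (pd i u) x),
      ← Fintype.sum_prod_type' (f := fun i j => pd j (pd i u) x ^ 2)]
    refine Real.abs_le_sqrt (Finset.sum_mul_sq_le_sq_mul_sq _ _ _) |>.trans ?_
    have : ∑ p : Fin n × Fin n, (v 1 p.1 * v 0 p.2) ^ 2 = (‖v 0‖ * ‖v 1‖) ^ 2 := by
      rw [Fintype.sum_prod_type, mul_pow, norm_sq_sum, norm_sq_sum, mul_comm, Finset.sum_mul_sum]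
      simp_rw [mul_pow]
    rw [this, mul_comm, Real.sqrt_mul (by positivity), Real.sqrt_sq (by positivity)]
    simp [Fin.prod_univ_two]
  calc _ ≤ √(∑ i, ∑ j, pd j (pd i u) x ^ 2) ^ 2 := by gcongr
    _ = _ := Real.sq_sqrt (by positivity)

theorem lap_iter {u : EE n → ℝ} (h : Sm u) (x : EE n) :
    (∑ i : Fin n, iteratedFDeriv ℝ 2 u x
                ![EuclideanSpace.single i 1, EuclideanSpace.single i 1]) = lap u x := by
  rw [lap]
  refine Finset.sum_congr rfl fun i _ => ?_
  rw [iteratedFDeriv_two_apply, fderiv2_eq h]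
  simp

theorem final (hn : 2 ≤ n)
    (key : ∀ (u : EE n → ℝ), TF u → ∀ j : ℕ, ((j:ℝ) + 1 / 2) ^ 2 *
      ∫ x, ‖x‖ ^ (-2 * ((j:ℝ) + 1 / 2) - n) * u x ^ 2
        ≤ 4 * ∫ x, ‖x‖ ^ (-2 * ((j:ℝ) + 1 / 2) + 4 - n) * lap u x ^ 2) :
    ∃ C : ℝ, 0 < C ∧
      ∀ u : EuclideanSpace ℝ (Fin n) → ℝ,
        ContDiff ℝ (⊤ : ℕ∞) u → HasCompactSupport u →
        (0 : EuclideanSpace ℝ (Fin n)) ∉ tsupport u →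
        ∀ j : ℕ,
          (∑ k ∈ Finset.range 3,
            ((j : ℝ) + 1 / 2) ^ ((2 : ℝ) - 2 * k) *
              ∫ x : EuclideanSpace ℝ (Fin n),
                ‖x‖ ^ (-2 * ((j : ℝ) + 1 / 2) + 2 * k - n) *
                  ‖iteratedFDeriv ℝ k u x‖ ^ 2) ≤
          C * ∫ x : EuclideanSpace ℝ (Fin n),
            ‖x‖ ^ (-2 * ((j : ℝ) + 1 / 2) + 4 - n) *
              (∑ i : Fin n, iteratedFDeriv ℝ 2 u x
                ![EuclideanSpace.single i 1, EuclideanSpace.single i 1]) ^ 2 := by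
  refine ⟨4 + (9 + 8 * n) + (6 + (2 * (n + 5) ^ 2 + 6 * (n + 5)) * (9 + 8 * n)), by positivity, ?_⟩
  intro u hu hc hz j
  have h : TF u := ⟨hu, hc, hz⟩
  have h0 := key u h j
  set m : ℝ := (j:ℝ) + 1 / 2 with hm
  have hm2 : 1 / 2 ≤ m := by rw [hm]; linarith [(Nat.cast_nonneg j : (0:ℝ) ≤ j)]
  have hmp : 0 < m := by linarith
  have h1 := est1 (by omega) h m hm2 h0
  have h2 := est2 h m hm2 h1
  simp_rw [lap_iter h.sm]
  set B := ∫ x, ‖x‖ ^ (-2 * m + 4 - n) * lap u x ^ 2 with hB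
  have hB0 : 0 ≤ B := integral_nonneg fun x => by positivity
  rw [Finset.sum_range_succ, Finset.sum_range_succ, Finset.sum_range_one]
  have t0 : m ^ ((2:ℝ) - 2 * (0:ℕ)) * ∫ x : EE n, ‖x‖ ^ (-2 * m + 2 * (0:ℕ) - n) *
                  ‖iteratedFDeriv ℝ 0 u x‖ ^ 2 ≤ 4 * B := by
    refine le_trans (le_of_eq ?_) h0
    simp
  have t1 : m ^ ((2:ℝ) - 2 * (1:ℕ)) * ∫ x : EE n, ‖x‖ ^ (-2 * m + 2 * (1:ℕ) - n) *
                  ‖iteratedFDeriv ℝ 1 u x‖ ^ 2 ≤ (9 + 8 * n) * B := by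
    have : m ^ ((2:ℝ) - 2 * (1:ℕ)) = 1 := by norm_num
    rw [this, one_mul]
    refine le_trans ?_ h1
    simp only [Nat.cast_one, mul_one]
    refine integral_mono_of_nonneg (Filter.Eventually.of_forall fun x => by positivity)
      (h.int_grad _) (Filter.Eventually.of_forall fun x => ?_)
    exact mul_le_mul_of_nonneg_left (norm_iter1 u x) (by positivity)
  have t2 : m ^ ((2:ℝ) - 2 * (2:ℕ)) * ∫ x : EE n, ‖x‖ ^ (-2 * m + 2 * (2:ℕ) - n) *
                  ‖iteratedFDeriv ℝ 2 u x‖ ^ 2 ≤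
      (6 + (2 * (n + 5) ^ 2 + 6 * (n + 5)) * (9 + 8 * n)) * B := by
    have e : m ^ ((2:ℝ) - 2 * (2:ℕ)) = (m ^ 2)⁻¹ := by
      rw [show (2:ℝ) - 2 * (2:ℕ) = -((2:ℕ):ℝ) by norm_num, Real.rpow_neg hmp.le, Real.rpow_natCast]
    rw [e, inv_mul_le_iff₀ (by positivity)]
    have e2 : -2 * m + 2 * (2:ℕ) - n = -2 * m + 4 - n := by norm_num
    rw [e2]
    refine le_trans ?_ (h2.trans (le_of_eq (by ring)))
    refine integral_mono_of_nonneg (Filter.Eventually.of_forall fun x => by positivity)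
      (h.int_hess _) (Filter.Eventually.of_forall fun x => ?_)
    exact mul_le_mul_of_nonneg_left (norm_iter2 h.sm x) (by positivity)
  linarith

end
end Carl

namespace Carl
noncomputable section
variable {n : ℕ}

abbrev SS (n : ℕ) := Metric.sphere (0 : EE n) 1
abbrev sig (n : ℕ) : Measure (SS n) := (volume : Measure (EE n)).toSphere

theorem param {K : Type*} [TopologicalSpace K] [CompactSpace K] [MeasurableSpace K] [BorelSpace K]
    (μ : Measure K) [IsFiniteMeasure μ] (F F' : ℝ → K → ℝ)
    (hF : ∀ t, Continuous (F t)) (hF' : Continuous (Function.uncurry F'))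
    (hd : ∀ t k, HasDerivAt (fun t => F t k) (F' t k) t) (t : ℝ) :
    HasDerivAt (fun t => ∫ k, F t k ∂μ) (∫ k, F' t k ∂μ) t := by
  obtain ⟨C, hC⟩ := ((isCompact_closedBall t 1).prod (isCompact_univ (X := K))).exists_bound_of_continuousOn
    hF'.continuousOn
  have ms : ∀ f : K → ℝ, Continuous f → AEStronglyMeasurable f μ := fun f hf =>
    (hf.stronglyMeasurable_of_hasCompactSupport (HasCompactSupport.of_compactSpace f)).aestronglyMeasurable
  refine (hasDerivAt_integral_of_dominated_loc_of_deriv_le (s := Metric.ball t 1) (bound := fun _ => C)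
    (Metric.ball_mem_nhds t one_pos) (Filter.Eventually.of_forall fun s => ms _ (hF s)) ?_ ?_ ?_
    (integrable_const C) ?_).2
  · exact (hF t).integrable_of_hasCompactSupport (HasCompactSupport.of_compactSpace _)
  · exact ms _ (hF'.comp (by fun_prop : Continuous fun k : K => (t, k)))
  · exact Filter.Eventually.of_forall fun k s hs => hC (s, k) ⟨Metric.ball_subset_closedBall hs, trivial⟩
  · exact Filter.Eventually.of_forall fun k s hs => hd s k

def ev {n : ℕ} (i : Fin n) : EE n := EuclideanSpace.single i 1

def rv (i j : Fin n) (t : ℝ) (x : EE n) : EE n :=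
  x + ((Real.cos t - 1) * x i - Real.sin t * x j) • ev i
    + (Real.sin t * x i + (Real.cos t - 1) * x j) • ev j

def rv' (i j : Fin n) (t : ℝ) (x : EE n) : EE n :=
  (- Real.sin t * x i - Real.cos t * x j) • ev i
    + (Real.cos t * x i + - Real.sin t * x j) • ev j

theorem rv_norm (i j : Fin n) (hij : i ≠ j) (t : ℝ) (x : EE n) : ‖rv i j t x‖ = ‖x‖ := by
  have h : ‖rv i j t x‖ ^ 2 = ‖x‖ ^ 2 := by
    have hc := Real.sin_sq_add_cos_sq t
    rw [rv]
    set a := (Real.cos t - 1) * x i - Real.sin t * x j with ha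
    set b := Real.sin t * x i + (Real.cos t - 1) * x j with hb
    rw [add_assoc, norm_add_sq_real, norm_add_sq_real, inner_add_right]
    simp only [ev, inner_smul_right, inner_smul_left, EuclideanSpace.inner_single_right, norm_smul,
      PiLp.norm_single]
    simp [hij]
    have : 2 * (a * x i + b * x j) + (a ^ 2 + b ^ 2) = 0 := by
      rw [ha, hb]
      have e : Real.sin t ^ 2 = 1 - Real.cos t ^ 2 := by linarith
      ring_nf
      rw [e]; ring
    linarith
  exact (sq_eq_sq₀ (norm_nonneg _) (norm_nonneg _)).1 h

def rvL (i j : Fin n) (hij : i ≠ j) (t : ℝ) : EE n →ₗᵢ[ℝ] EE n where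
  toFun := rv i j t
  map_add' x y := by
    simp only [rv, PiLp.add_apply]; module
  map_smul' c x := by
    simp only [rv, PiLp.smul_apply, smul_eq_mul, RingHom.id_apply]; module
  norm_map' x := rv_norm i j hij t x

def rvE (i j : Fin n) (hij : i ≠ j) (t : ℝ) : EE n ≃ₗᵢ[ℝ] EE n :=
  (rvL i j hij t).toLinearIsometryEquiv rfl

open scoped Pointwise in
theorem sphere_inv (R : EE n ≃ₗᵢ[ℝ] EE n) (F : EE n → ℝ) (hF : Continuous F) :
    ∫ w : SS n, F (R w) ∂(sig n) = ∫ w : SS n, F w ∂(sig n) := by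
  let φ : SS n → SS n := fun w => ⟨R w, by simp⟩
  have hφ : Continuous φ := by
    apply Continuous.subtype_mk; exact R.continuous.comp continuous_subtype_val
  have hmap : (sig n).map φ = sig n := by
    ext s hs
    rw [Measure.map_apply hφ.measurable hs, sig, Measure.toSphere_apply' _ (hφ.measurable hs),
      Measure.toSphere_apply' _ hs]
    congr 1
    have : (Set.Ioo (0:ℝ) 1 • (Subtype.val '' (φ ⁻¹' s)) : Set (EE n)) =
        R ⁻¹' (Set.Ioo (0:ℝ) 1 • (Subtype.val '' s)) := by
      ext x
      simp only [Set.mem_smul, Set.mem_image, Set.mem_preimage]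
      constructor
      · rintro ⟨r, hr, _, ⟨w, hw, rfl⟩, rfl⟩
        exact ⟨r, hr, _, ⟨φ w, hw, rfl⟩, by simp [φ]⟩
      · rintro ⟨r, hr, _, ⟨w, hw, rfl⟩, h⟩
        refine ⟨r, hr, R.symm w, ⟨⟨R.symm w, by simp⟩, ?_, rfl⟩, ?_⟩
        · simpa [φ] using hw
        · apply R.injective; simp [h]
    rw [this]
    exact R.measurePreserving.measure_preimage_equiv (f := R.toHomeomorph.toMeasurableEquiv) _
  have : ∫ w : SS n, F w ∂(sig n) = ∫ w : SS n, F w ∂((sig n).map φ) := by rw [hmap]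
  rw [this, integral_map hφ.measurable.aemeasurable]
  exact (hF.comp continuous_subtype_val).aestronglyMeasurable

theorem rot_int {F : EE n → ℝ} (h : Sm F) (i j : Fin n) :
    ∫ w : SS n, rot i j F w ∂(sig n) = 0 := by
  by_cases hij : i = j
  · subst hij; simp [rot]
  have hd1 : ∀ t x, HasDerivAt (fun t => rv i j t x) (rv' i j t x) t := by
    intro t x
    have h1 := (((Real.hasDerivAt_cos t).sub_const 1).mul_const (x i)).fun_sub
      ((Real.hasDerivAt_sin t).mul_const (x j))
    have h2 := ((Real.hasDerivAt_sin t).mul_const (x i)).fun_add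
      (((Real.hasDerivAt_cos t).sub_const 1).mul_const (x j))
    have h3 := ((h1.smul_const (ev i)).const_add x).fun_add (h2.smul_const (ev j))
    exact h3
  have hdF : Continuous (fderiv ℝ F) := h.continuous_fderiv (by simp)
  have c1 : Continuous fun p : ℝ × SS n => rv i j p.1 (p.2 : EE n) := by
    unfold rv; fun_prop
  have c2 : Continuous fun p : ℝ × SS n => rv' i j p.1 (p.2 : EE n) := by
    unfold rv'; fun_prop
  have key := param (sig n) (fun t w => F (rv i j t w)) (fun t w => fderiv ℝ F (rv i j t w) (rv' i j t w))
    (fun t => h.cont.comp (c1.comp (by fun_prop : Continuous fun w : SS n => (t, w))))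
    ((hdF.comp c1).clm_apply c2)
    (fun t w => ((h.diff (rv i j t w)).hasFDerivAt.comp_hasDerivAt t (hd1 t w))) 0
  have hc : (fun t => ∫ w : SS n, F (rv i j t w) ∂(sig n)) = fun _ => ∫ w : SS n, F w ∂(sig n) := by
    ext t
    exact sphere_inv (rvE i j hij t) F h.cont
  rw [hc] at key
  have := key.unique (hasDerivAt_const _ _)
  rw [← this]
  congr 1; ext w
  have e1 : rv i j 0 (w : EE n) = w := by simp [rv]
  rw [e1, rv']
  simp only [rot, pd, map_add, map_smul, ev]
  simp; ring

theorem rot_mul {F G : EE n → ℝ} (h : Sm F) (hg : Sm G) (i j : Fin n) (x) :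
    rot i j (fun x => F x * G x) x = F x * rot i j G x + G x * rot i j F x := by
  simp only [rot, pd_mul h hg]; ring

theorem Sm.intS {F : EE n → ℝ} (h : Sm F) : Integrable (fun w : SS n => F w) (sig n) :=
  (h.cont.comp continuous_subtype_val).integrable_of_hasCompactSupport (HasCompactSupport.of_compactSpace _)

theorem rot_anti {F G : EE n → ℝ} (h : Sm F) (hg : Sm G) (i j : Fin n) :
    ∫ w : SS n, rot i j F w * G w ∂(sig n) = - ∫ w : SS n, F w * rot i j G w ∂(sig n) := by
  have := rot_int (h.mul hg) i j
  simp_rw [rot_mul h hg] at this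
  rw [integral_add (h.mul (hg.rot i j)).intS (hg.mul (h.rot i j)).intS] at this
  have e : ∫ w : SS n, rot i j F w * G w ∂(sig n) = ∫ w : SS n, G w * rot i j F w ∂(sig n) := by
    congr 1; ext w; ring
  rw [e]; linarith

theorem sph_symm {F G : EE n → ℝ} (h : Sm F) (hg : Sm G) :
    ∫ w : SS n, sph F w * G w ∂(sig n) = ∫ w : SS n, F w * sph G w ∂(sig n) := by
  have e1 : ∫ w : SS n, sph F w * G w ∂(sig n)
      = (1/2) * ∑ i, ∑ j, ∫ w : SS n, rot i j (rot i j F) w * G w ∂(sig n) := by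
    simp_rw [sph, mul_assoc, Finset.sum_mul]
    rw [integral_const_mul, integral_finsetSum]
    · congr 1
      refine Finset.sum_congr rfl fun i _ => ?_
      rw [integral_finsetSum]
      exact fun j _ => (((h.rot i j).rot i j).mul hg).intS
    · exact fun i _ => integrable_finsetSum _ fun j _ => (((h.rot i j).rot i j).mul hg).intS
  have e2 : ∫ w : SS n, F w * sph G w ∂(sig n)
      = (1/2) * ∑ i, ∑ j, ∫ w : SS n, F w * rot i j (rot i j G) w ∂(sig n) := by
    simp_rw [sph, mul_left_comm (F _)]
    rw [integral_const_mul]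
    congr 1
    simp_rw [Finset.mul_sum]
    rw [integral_finsetSum]
    · refine Finset.sum_congr rfl fun i _ => ?_
      rw [integral_finsetSum]
      exact fun j _ => (h.mul ((hg.rot i j).rot i j)).intS
    · exact fun i _ => integrable_finsetSum _ fun j _ => (h.mul ((hg.rot i j).rot i j)).intS
  rw [e1, e2]
  congr 1
  refine Finset.sum_congr rfl fun i _ => Finset.sum_congr rfl fun j _ => ?_
  rw [rot_anti (h.rot i j) hg, rot_anti h (hg.rot i j), neg_neg]

end
end Carl

namespace Carl
noncomputable section
variable {n : ℕ}

def crd {n : ℕ} (i : Fin n) : C(EE n, ℝ) := ⟨fun x => x i, by fun_prop⟩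

def MM (n : ℕ) : Submodule ℝ C(EE n, ℝ) := Submodule.span ℝ (insert 1 (Set.range crd))

def NN (n : ℕ) : ℕ → Submodule ℝ C(EE n, ℝ)
  | 0 => ⊥
  | d + 1 => MM n ^ d

theorem one_mem_MM : (1 : C(EE n, ℝ)) ∈ MM n := Submodule.subset_span (Set.mem_insert _ _)
theorem crd_mem_MM (i : Fin n) : crd i ∈ MM n :=
  Submodule.subset_span (Set.mem_insert_of_mem _ ⟨i, rfl⟩)

theorem NN_succ (d : ℕ) : NN n d ≤ NN n (d + 1) := by
  cases d with
  | zero => exact bot_le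
  | succ d =>
    intro p hp
    change p ∈ MM n ^ (d + 1)
    rw [pow_succ', ← one_mul p]
    exact Submodule.mul_mem_mul one_mem_MM hp

theorem NN_mono : Monotone (NN n) := monotone_nat_of_le_succ NN_succ

theorem MM_mul_NN (d : ℕ) {m p : C(EE n, ℝ)} (hm : m ∈ MM n) (hp : p ∈ NN n d) :
    m * p ∈ NN n (d + 1) := by
  cases d with
  | zero =>
    have : p = 0 := hp
    simp [this]
  | succ d =>
    change m * p ∈ MM n ^ (d + 1)
    rw [pow_succ']
    exact Submodule.mul_mem_mul hm hp

theorem MM_prop {m : C(EE n, ℝ)} (hm : m ∈ MM n) :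
    Sm m ∧ (∀ i, ∃ c : ℝ, ∀ x, pd i m x = c) ∧ ∃ c : ℝ, ∀ x, eul m x = m x + c := by
  induction hm using Submodule.span_induction with
  | mem p hp =>
    rcases hp with rfl | ⟨j, rfl⟩
    · have e : ⇑(1 : C(EE n, ℝ)) = fun _ => (1:ℝ) := rfl
      rw [e]
      exact ⟨sm_const 1, fun i => ⟨0, fun x => pd_const 1 i x⟩, -1, fun x => by simp [eul, pd_const]⟩
    · have e : ⇑(crd j) = fun x : EE n => x j := rfl
      rw [e]
      exact ⟨sm_coord j, fun i => ⟨_, fun x => pd_coord i j x⟩, 0, fun x => by simp [eul, pd_coord]⟩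
  | zero =>
    have e : ⇑(0 : C(EE n, ℝ)) = fun _ => (0:ℝ) := rfl
    rw [e]
    exact ⟨sm_const 0, fun i => ⟨0, fun x => pd_const 0 i x⟩, 0, fun x => by simp [eul, pd_const]⟩
  | add p q _ _ hp hq =>
    obtain ⟨s1, a1, c1, b1⟩ := hp
    obtain ⟨s2, a2, c2, b2⟩ := hq
    have e : ⇑(p + q) = fun x => p x + q x := rfl
    rw [e]
    refine ⟨s1.add s2, fun i => ?_, c1 + c2, fun x => ?_⟩
    · obtain ⟨d1, h1⟩ := a1 i
      obtain ⟨d2, h2⟩ := a2 i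
      exact ⟨d1 + d2, fun x => by rw [pd_add s1 s2, h1, h2]⟩
    · have := b1 x
      have := b2 x
      simp only [eul] at *
      simp_rw [pd_add s1 s2, mul_add, Finset.sum_add_distrib]
      linarith
  | smul a p _ hp =>
    obtain ⟨s1, a1, c1, b1⟩ := hp
    have e : ⇑(a • p) = fun x => a * p x := rfl
    rw [e]
    refine ⟨(sm_const a).mul s1, fun i => ?_, a * c1, fun x => ?_⟩
    · obtain ⟨d1, h1⟩ := a1 i
      exact ⟨a * d1, fun x => by rw [pd_cmul s1, h1]⟩
    · have := b1 x
      simp only [eul] at *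
      simp_rw [pd_cmul s1, mul_left_comm _ a, ← Finset.mul_sum]
      rw [this]; ring

theorem pow_prop (d : ℕ) : ∀ p ∈ NN n (d + 1),
    Sm p ∧ (∀ i, ∃ q ∈ NN n d, ∀ x, pd i p x = q x) ∧ ∃ q ∈ NN n d, ∀ x, eul p x = d * p x + q x := by
  induction d with
  | zero =>
    intro p hp
    have hp : p ∈ MM n ^ 0 := hp
    rw [pow_zero, Submodule.mem_one] at hp
    obtain ⟨c, rfl⟩ := hp
    have e : ⇑(algebraMap ℝ C(EE n, ℝ) c) = fun _ => c := by ext; simp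
    rw [e]
    exact ⟨sm_const c, fun i => ⟨0, Submodule.zero_mem _, fun x => by simp [pd_const]⟩,
      0, Submodule.zero_mem _, fun x => by simp [eul, pd_const]⟩
  | succ d ih =>
    intro p hp
    have hp : p ∈ MM n ^ (d + 1) := hp
    rw [pow_succ'] at hp
    refine Submodule.mul_induction_on hp ?_ ?_
    · intro m hm q hq
      obtain ⟨s1, a1, c, b1⟩ := MM_prop hm
      obtain ⟨s2, a2, r, hr, b2⟩ := ih q hq
      have e : ⇑(m * q) = fun x => m x * q x := rfl
      rw [e]
      refine ⟨s1.mul s2, fun i => ?_, m * r + c • q, ?_, fun x => ?_⟩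
      · obtain ⟨d1, h1⟩ := a1 i
        obtain ⟨q', hq', h2⟩ := a2 i
        refine ⟨m * q' + d1 • q, Submodule.add_mem _ (MM_mul_NN d hm hq') (Submodule.smul_mem _ _ hq),
          fun x => ?_⟩
        rw [pd_mul s1 s2, h1, h2]
        simp; ring
      · exact Submodule.add_mem _ (MM_mul_NN d hm hr) (Submodule.smul_mem _ _ hq)
      · have h1 := b1 x
        have h2 := b2 x
        have : eul (fun x => m x * q x) x = m x * eul q x + q x * eul m x := by
          simp only [eul, pd_mul s1 s2, Finset.mul_sum, ← Finset.sum_add_distrib]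
          exact Finset.sum_congr rfl fun i _ => by ring
        rw [this, h1, h2]
        simp; ring
    · intro p q hp hq
      obtain ⟨s1, a1, r1, c1, b1⟩ := hp
      obtain ⟨s2, a2, r2, c2, b2⟩ := hq
      have e : ⇑(p + q) = fun x => p x + q x := rfl
      rw [e]
      refine ⟨s1.add s2, fun i => ?_, r1 + r2, Submodule.add_mem _ c1 c2, fun x => ?_⟩
      · obtain ⟨d1, h1, g1⟩ := a1 i
        obtain ⟨d2, h2, g2⟩ := a2 i
        exact ⟨d1 + d2, Submodule.add_mem _ h1 h2, fun x => by rw [pd_add s1 s2, g1, g2]; rfl⟩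
      · have := b1 x
        have := b2 x
        have : eul (fun x => p x + q x) x = eul p x + eul q x := by
          simp only [eul, pd_add s1 s2, mul_add, ← Finset.sum_add_distrib]
        rw [this, b1, b2]; simp; ring

theorem NN_sm {d : ℕ} {p : C(EE n, ℝ)} (hp : p ∈ NN n d) : Sm p :=
  (pow_prop d p (NN_succ d hp)).1

theorem NN_pd {d : ℕ} {p : C(EE n, ℝ)} (hp : p ∈ NN n d) (i : Fin n) :
    ∃ q ∈ NN n d, pd i p = q := by
  obtain ⟨q, hq, h⟩ := (pow_prop d p (NN_succ d hp)).2.1 i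
  exact ⟨q, hq, funext h⟩

theorem NN_eul {d : ℕ} {p : C(EE n, ℝ)} (hp : p ∈ NN n d) :
    ∃ q ∈ NN n d, eul p = q := by
  obtain ⟨q, hq, h⟩ := (pow_prop d p (NN_succ d hp)).2.2
  refine ⟨(d : ℝ) • p + q, Submodule.add_mem _ (Submodule.smul_mem _ _ hp) hq, ?_⟩
  ext x; rw [h]; simp

theorem sph_poly {d : ℕ} {p : C(EE n, ℝ)} (hp : p ∈ NN n (d + 1)) :
    ∃ h ∈ NN n d, ∀ x : EE n, ‖x‖ = 1 → sph p x = -((d : ℝ) * (d + n - 2)) * p x + h x := by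
  obtain ⟨s, a, q, hq, b⟩ := pow_prop d p hp
  obtain ⟨q2, hq2, b2⟩ := NN_eul hq
  choose r hr hr' using a
  have hr2 : ∀ i, ∃ l ∈ NN n d, pd i (pd i p) = l := by
    intro i
    have : pd i p = r i := funext (hr' i)
    rw [this]; exact NN_pd (hr i) i
  choose l hl hl' using hr2
  refine ⟨∑ i, l i - ((d:ℝ) • q + q2) - ((n:ℝ) - 2) • q, ?_, fun x hx => ?_⟩
  · exact Submodule.sub_mem _ (Submodule.sub_mem _ (Submodule.sum_mem _ fun i _ => hl i)
      (Submodule.add_mem _ (Submodule.smul_mem _ _ hq) hq2)) (Submodule.smul_mem _ _ hq)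
  · rw [sph_eq s, hx]
    have e1 : lap p x = (∑ i, l i : C(EE n, ℝ)) x := by
      rw [lap, ContinuousMap.sum_apply]; simp_rw [hl']
    have e2 : eul (eul p) x = d * eul p x + q2 x := by
      have : eul p = fun x => d * p x + q x := funext b
      have sq : Sm q := NN_sm hq
      rw [← b2, this]
      simp only [eul, pd_add ((sm_const (d:ℝ)).mul s) sq, pd_cmul s]
      rw [← b x]
      simp only [eul, Finset.mul_sum, ← Finset.sum_add_distrib]
      exact Finset.sum_congr rfl fun i _ => by ring
    rw [e2, b, e1]
    simp; ring

end
end Carl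

namespace Carl
noncomputable section
variable {n : ℕ}

def res (n : ℕ) : C(EE n, ℝ) →ₐ[ℝ] C(SS n, ℝ) :=
  ContinuousMap.compRightAlgHom ℝ ℝ ⟨Subtype.val, continuous_subtype_val⟩

def TT (n : ℕ) : C(EE n, ℝ) →ₗ[ℝ] Lp ℝ 2 (sig n) :=
  (ContinuousMap.toLp 2 (sig n) ℝ).toLinearMap ∘ₗ (res n).toLinearMap

theorem inner_TT (p q : C(EE n, ℝ)) :
    inner ℝ (TT n p) (TT n q) = ∫ w : SS n, p w * q w ∂(sig n) := by
  change inner ℝ (ContinuousMap.toLp 2 (sig n) ℝ (res n p)) (ContinuousMap.toLp 2 (sig n) ℝ (res n q)) = _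
  rw [ContinuousMap.inner_toLp]
  congr 1; ext w
  simp [res, mul_comm]

def WW (n k : ℕ) : Submodule ℝ (Lp ℝ 2 (sig n)) := (NN n k).map (TT n)

instance WW_fin (k : ℕ) : FiniteDimensional ℝ (WW n k) := by
  apply Module.Finite.iff_fg.2
  apply Submodule.FG.map
  cases k with
  | zero => exact Submodule.fg_bot
  | succ k =>
    apply Submodule.FG.pow
    exact Submodule.fg_span ((Set.finite_range _).insert _)

theorem WW_mono : Monotone (WW n) := fun _ _ h => Submodule.map_mono (NN_mono h)

def VV (n k : ℕ) : Submodule ℝ (Lp ℝ 2 (sig n)) := (WW n k)ᗮ ⊓ WW n (k + 1)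

instance VV_fin (k : ℕ) : FiniteDimensional ℝ (VV n k) :=
  Submodule.finiteDimensional_inf_right _ _

theorem VV_orth : OrthogonalFamily ℝ (fun k => VV n k) (fun k => (VV n k).subtypeₗᵢ) := by
  apply OrthogonalFamily.of_pairwise
  have aux : ∀ k l, k < l → VV n k ⟂ VV n l := by
    intro k l h
    rw [Submodule.isOrtho_iff_le]
    intro x hx
    have h1 : x ∈ WW n l := WW_mono h hx.2
    rw [Submodule.mem_orthogonal]
    intro y hy
    rw [real_inner_comm]
    exact (Submodule.mem_orthogonal _ _).1 hy.1 x h1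
  intro k l h
  rcases lt_or_gt_of_ne h with h | h
  · exact aux k l h
  · exact (aux l k h).symm

theorem WW_dense : (⨆ k, WW n k).topologicalClosure = ⊤ := by
  have hA : (Algebra.adjoin ℝ (Set.range fun i : Fin n => res n (crd i))).topologicalClosure = ⊤ := by
    apply ContinuousMap.subalgebra_topologicalClosure_eq_top_of_separatesPoints
    intro x y hxy
    have : ∃ i, (x : EE n) i ≠ (y : EE n) i := by
      by_contra! h
      apply hxy
      ext i; exact h i
    obtain ⟨i, hi⟩ := this
    exact ⟨_, ⟨_, Algebra.subset_adjoin ⟨i, rfl⟩, rfl⟩, hi⟩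
  have hB : ∀ f ∈ Algebra.adjoin ℝ (Set.range fun i : Fin n => res n (crd i)),
      ∃ d, ∃ p ∈ MM n ^ d, res n p = f := by
    intro f hf
    induction hf using Algebra.adjoin_induction with
    | mem f hf =>
      obtain ⟨i, rfl⟩ := hf
      exact ⟨1, crd i, by rw [pow_one]; exact crd_mem_MM i, rfl⟩
    | algebraMap r => exact ⟨0, algebraMap ℝ _ r, by
        rw [pow_zero]; exact Submodule.algebraMap_mem r, (res n).commutes r⟩
    | add f g _ _ hf hg =>
      obtain ⟨d, p, hp, rfl⟩ := hf
      obtain ⟨e, q, hq, rfl⟩ := hg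
      refine ⟨max d e, p + q, Submodule.add_mem _ ?_ ?_, map_add _ _ _⟩
      · exact (NN_mono (n := n) (show d + 1 ≤ max d e + 1 by simp)) hp
      · exact (NN_mono (n := n) (show e + 1 ≤ max d e + 1 by simp)) hq
    | mul f g _ _ hf hg =>
      obtain ⟨d, p, hp, rfl⟩ := hf
      obtain ⟨e, q, hq, rfl⟩ := hg
      exact ⟨d + e, p * q, by rw [pow_add]; exact Submodule.mul_mem_mul hp hq, map_mul _ _ _⟩
  have hC : (Subalgebra.toSubmodule (Algebra.adjoin ℝ (Set.range fun i : Fin n => res n (crd i)))).topologicalClosure = ⊤ := by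
    have := congrArg Subalgebra.toSubmodule hA
    exact this
  have hD := (ContinuousMap.toLp_denseRange (p := 2) ℝ ℝ (μ := sig n) (by norm_num)).topologicalClosure_map_submodule hC
  rw [eq_top_iff, ← hD]
  apply Submodule.topologicalClosure_mono
  rintro _ ⟨f, hf, rfl⟩
  obtain ⟨d, p, hp, rfl⟩ := hB f hf
  exact (le_iSup (WW n) (d + 1)) ⟨p, hp, rfl⟩

theorem exists_basis (n : ℕ) : ∃ (ι : Type) (_ : Countable ι) (b : HilbertBasis ι ℝ (Lp ℝ 2 (sig n)))
    (k : ι → ℕ) (p : ι → C(EE n, ℝ)), (∀ i, p i ∈ NN n (k i + 1)) ∧ (∀ i, b i = TT n (p i)) ∧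
      ∀ i, TT n (p i) ∈ (WW n (k i))ᗮ := by
  let B : ∀ k, OrthonormalBasis (Fin (Module.finrank ℝ (VV n k))) ℝ (VV n k) := fun k => stdOrthonormalBasis ℝ _
  have hB := VV_orth.orthonormal_sigma_orthonormal (fun k => (B k).orthonormal)
  let v : (Σ k, Fin (Module.finrank ℝ (VV n k))) → Lp ℝ 2 (sig n) := fun a => (B a.1 a.2 : Lp ℝ 2 (sig n))
  have hv : Orthonormal ℝ v := hB
  have hVs : ∀ k, VV n k ≤ Submodule.span ℝ (Set.range v) := by
    intro k x hx
    have := (B k).sum_repr ⟨x, hx⟩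
    have := congrArg Subtype.val this
    simp only at this
    rw [← this]
    rw [Submodule.coe_sum]
    refine Submodule.sum_mem _ fun i _ => Submodule.smul_mem _ _ (Submodule.subset_span ⟨⟨k, i⟩, rfl⟩)
  have hWs : ∀ k, WW n k ≤ Submodule.span ℝ (Set.range v) := by
    intro k
    induction k with
    | zero => simp [WW, NN]
    | succ k ih =>
      rw [← Submodule.sup_orthogonal_inf_of_hasOrthogonalProjection (WW_mono (n := n) k.le_succ)]
      exact sup_le ih (hVs k)
  have hd : ⊤ ≤ (Submodule.span ℝ (Set.range v)).topologicalClosure := by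
    rw [← WW_dense]
    exact Submodule.topologicalClosure_mono (iSup_le hWs)
  have hp : ∀ a : (Σ k, Fin (Module.finrank ℝ (VV n k))), ∃ p ∈ NN n (a.1 + 1), TT n p = v a := fun a =>
    (B a.1 a.2).2.2
  choose p hp hp' using hp
  refine ⟨_, inferInstance, HilbertBasis.mk hv hd, fun a => a.1, p, hp, fun a => ?_, fun a => ?_⟩
  · rw [HilbertBasis.coe_mk, hp']
  · rw [hp']; exact (B a.1 a.2).2.1

/-- eigenfunction property, tested against smooth functions -/
theorem eigen {k : ℕ} {p : C(EE n, ℝ)} (hp : p ∈ NN n (k + 1)) (ho : TT n p ∈ (WW n k)ᗮ)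
    {F : EE n → ℝ} (hF : Sm F) :
    ∫ w : SS n, sph F w * p w ∂(sig n) = -((k:ℝ) * (k + n - 2)) * ∫ w : SS n, F w * p w ∂(sig n) := by
  obtain ⟨h, hh, e⟩ := sph_poly hp
  have sp : Sm p := NN_sm hp
  have sh : Sm h := NN_sm hh
  have nw : ∀ w : SS n, ‖(w : EE n)‖ = 1 := fun w => by simp
  have orth : ∀ q ∈ NN n k, ∫ w : SS n, q w * p w ∂(sig n) = 0 := by
    intro q hq
    rw [← inner_TT]
    exact (Submodule.mem_orthogonal _ _).1 ho _ ⟨q, hq, rfl⟩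
  have h0 : ∫ w : SS n, h w * h w ∂(sig n) = 0 := by
    have hs : ∃ g ∈ NN n k, ∀ w : SS n, sph h w = g w := by
      cases k with
      | zero =>
        have : h = 0 := hh
        subst this
        refine ⟨0, Submodule.zero_mem _, fun w => ?_⟩
        have e0 : ⇑(0 : C(EE n, ℝ)) = fun _ => (0:ℝ) := rfl
        rw [e0]
        have r0 : ∀ i j, rot i j (fun _ : EE n => (0:ℝ)) = fun _ => 0 := by
          intro i j; ext x; simp [rot, pd_const]
        simp [sph, r0]
      | succ k =>
        obtain ⟨g, hg, eg⟩ := sph_poly hh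
        refine ⟨(-((k:ℝ) * (k + n - 2))) • h + g, Submodule.add_mem _ (Submodule.smul_mem _ _ hh) (NN_succ _ hg),
          fun w => ?_⟩
        rw [eg w (nw w)]; simp
    obtain ⟨g, hg, eg⟩ := hs
    have e1 : ∀ w : SS n, h w * h w = p w * 0 + sph p w * h w + ((k:ℝ) * (k + n - 2)) * (h w * p w) := by
      intro w; rw [e w (nw w)]; ring
    simp_rw [e1, mul_zero, zero_add]
    rw [integral_add (sp.sph.mul sh).intS (((sm_const _).mul (sh.mul sp)).intS), integral_const_mul,
      orth h hh, sph_symm sp sh]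
    simp_rw [eg, mul_comm (p _)]
    rw [orth g hg]; simp
  have h1 : TT n h = 0 := by
    rw [← inner_self_eq_zero (𝕜 := ℝ), inner_TT, h0]
  have h2 : ∫ w : SS n, F w * h w ∂(sig n) = 0 := by
    have := inner_TT ⟨F, hF.cont⟩ h
    rw [h1, inner_zero_right] at this
    exact this.symm
  rw [sph_symm hF sp]
  have e1 : ∀ w : SS n, F w * sph p w = -((k:ℝ) * (k + n - 2)) * (F w * p w) + F w * h w := by
    intro w; rw [e w (nw w)]; ring
  simp_rw [e1]
  rw [integral_add ((sm_const _).mul (hF.mul sp)).intS (hF.mul sh).intS, integral_const_mul, h2, add_zero]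

end
end Carl

namespace Carl
noncomputable section
variable {n : ℕ}

structure RF (b : ℝ → ℝ) : Prop where
  c : Continuous b
  z : ∃ ε > 0, ∃ R : ℝ, ∀ r, 0 ≤ r → (r < ε ∨ R < r) → b r = 0

theorem RF.int {b c : ℝ → ℝ} (hb : RF b) (hc : Continuous c) (s : ℝ) :
    IntegrableOn (fun r => r ^ s * (b r * c r)) (Set.Ioi 0) := by
  obtain ⟨ε, h0, R, h⟩ := hb.z
  have hb := hb.c
  have h1 : IntegrableOn (fun r => r ^ s * (b r * c r)) (Set.Icc ε R) := by
    apply ContinuousOn.integrableOn_compact isCompact_Icc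
    intro r hr
    apply ContinuousAt.continuousWithinAt
    exact (Real.continuousAt_rpow_const _ _ (Or.inl (h0.trans_le hr.1).ne')).mul
      (hb.mul hc).continuousAt
  refine h1.of_forall_sdiff_eq_zero measurableSet_Ioi ?_
  rintro r ⟨hr, hr'⟩
  have : r < ε ∨ R < r := by
    by_contra! hh
    exact hr' hh
  simp [h r (le_of_lt hr) this]

theorem oneD {b c : ℝ → ℝ} (hb : RF b) (hc : RF c) (hd : ∀ r, 0 < r → HasDerivAt b (c r / r) r)
    (m κ : ℝ) :
    (m - κ) ^ 2 * ∫ r in Set.Ioi (0:ℝ), r ^ (-2 * m - 1) * b r ^ 2 ≤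
      ∫ r in Set.Ioi (0:ℝ), r ^ (-2 * m - 1) * (c r - κ * b r) ^ 2 := by
  have cb := hb.c
  have cc := hc.c
  have e1 : ∀ r ∈ Set.Ioi (0:ℝ), HasDerivAt (fun r => r ^ (-2 * m) * (b r) ^ 2)
      (r ^ (-2 * m - 1) * (b r * (2 * (c r - m * b r)))) r := by
    intro r hr
    have hr : 0 < r := hr
    have h1 := (Real.hasDerivAt_rpow_const (p := -2 * m) (Or.inl hr.ne')).fun_mul ((hd r hr).fun_pow 2)
    refine h1.congr_deriv ?_
    have e : r ^ (-2 * m) = r ^ (-2 * m - 1) * r := by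
      conv_rhs => rw [← Real.rpow_add_one hr.ne']
      ring_nf
    rw [e]; field_simp; norm_num; ring
  have i0 := hb.int (c := fun r => 2 * (c r - m * b r)) (by fun_prop) (-2 * m - 1)
  have hI : ∫ r in Set.Ioi (0:ℝ), r ^ (-2 * m - 1) * (b r * (2 * (c r - m * b r))) = 0 := by
    obtain ⟨ε, h0, R, h⟩ := hb.z
    have b0 : b 0 = 0 := h 0 le_rfl (Or.inl h0)
    rw [integral_Ioi_of_hasDerivAt_of_tendsto (m := 0) ?_ e1 i0 ?_]
    · simp [b0]
    · have : (fun r : ℝ => r ^ (-2 * m) * (b r) ^ 2) =ᶠ[nhdsWithin 0 (Set.Ici 0)] fun _ => 0 := by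
        filter_upwards [self_mem_nhdsWithin, mem_nhdsWithin_of_mem_nhds (Iio_mem_nhds h0)] with r hr hr'
        simp [h r hr (Or.inl hr')]
      exact continuousWithinAt_const.congr_of_eventuallyEq this (by simp [b0])
    · have : (fun r : ℝ => r ^ (-2 * m) * (b r) ^ 2) =ᶠ[Filter.atTop] fun _ => 0 := by
        filter_upwards [Filter.eventually_gt_atTop R, Filter.eventually_ge_atTop 0] with r hr hr'
        simp [h r hr' (Or.inr hr)]
      exact tendsto_const_nhds.congr' this.symm
  have i1 := hb.int (c := b) cb (-2 * m - 1)
  have i2 : IntegrableOn (fun r => r ^ (-2 * m - 1) * (c r - κ * b r) ^ 2) (Set.Ioi 0) := by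
    have a1 := hc.int (c := fun r => c r - 2 * κ * b r) (by fun_prop) (-2 * m - 1)
    have a2 := hb.int (c := fun r => κ ^ 2 * b r) (by fun_prop) (-2 * m - 1)
    refine (a1.add a2).congr_fun (fun r _ => ?_) measurableSet_Ioi
    simp only [Pi.add_apply]; ring
  have hfin : ∫ r in Set.Ioi (0:ℝ), ((m - κ) ^ 2 * (r ^ (-2 * m - 1) * (b r * b r)) +
      (m - κ) * (r ^ (-2 * m - 1) * (b r * (2 * (c r - m * b r))))) ≤
      ∫ r in Set.Ioi (0:ℝ), r ^ (-2 * m - 1) * (c r - κ * b r) ^ 2 := by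
    apply setIntegral_mono_on ((i1.const_mul _).add (i0.const_mul _)) i2 measurableSet_Ioi
    intro r hr
    have : 0 ≤ r ^ (-2 * m - 1) := Real.rpow_nonneg (le_of_lt hr) _
    have := mul_nonneg this (sq_nonneg (c r - m * b r))
    simp only [Pi.add_apply]
    nlinarith
  rw [integral_add (i1.const_mul _) (i0.const_mul _), integral_const_mul, integral_const_mul, hI] at hfin
  simpa [pow_two] using hfin

/-! scaling -/
theorem Sm.scale {F : EE n → ℝ} (h : Sm F) (r : ℝ) : Sm (fun x => F (r • x)) :=
  h.comp (contDiff_const_smul r)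

theorem pd_scale {F : EE n → ℝ} (h : Sm F) (r : ℝ) (i : Fin n) (x) :
    pd i (fun x => F (r • x)) x = r * pd i F (r • x) := by
  have h1 : HasFDerivAt (fun x : EE n => r • x) (r • ContinuousLinearMap.id ℝ (EE n)) x :=
    (hasFDerivAt_id x).const_smul r
  have h2 := (h.diff (r • x)).hasFDerivAt.comp x h1
  have h3 : fderiv ℝ (fun x => F (r • x)) x = _ := h2.fderiv
  simp only [pd]
  rw [h3]; simp

theorem rot_scale {F : EE n → ℝ} (h : Sm F) (r : ℝ) (i j : Fin n) (x) :
    rot i j (fun x => F (r • x)) x = rot i j F (r • x) := by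
  simp only [rot, pd_scale h]; simp; ring

theorem sph_scale {F : EE n → ℝ} (h : Sm F) (r : ℝ) (x) :
    sph (fun x => F (r • x)) x = sph F (r • x) := by
  simp only [sph]
  have : ∀ i j, rot i j (fun x => F (r • x)) = fun x => rot i j F (r • x) := fun i j => funext (rot_scale h r i j)
  simp_rw [this, rot_scale (h.rot _ _)]

def PP (p : C(EE n, ℝ)) (w : EE n → ℝ) (r : ℝ) : ℝ := ∫ ω : SS n, w (r • (ω : EE n)) * p ω ∂(sig n)

theorem PP_deriv (p : C(EE n, ℝ)) {w : EE n → ℝ} (h : Sm w) (r : ℝ) :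
    HasDerivAt (PP p w) (∫ ω : SS n, fderiv ℝ w (r • (ω : EE n)) ω * p ω ∂(sig n)) r := by
  have hdF : Continuous (fderiv ℝ w) := h.continuous_fderiv (by simp)
  have cw := h.cont
  have cp := p.continuous
  refine param (sig n) (fun r ω => w (r • (ω : EE n)) * p ω)
    (fun r ω => fderiv ℝ w (r • (ω : EE n)) ω * p ω) (fun t => ?_) ?_ (fun t ω => ?_) r
  · fun_prop
  · have : Continuous fun q : ℝ × SS n => fderiv ℝ w (q.1 • (q.2 : EE n)) q.2 * p q.2 := by
      fun_prop
    exact this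
  · have h1 : HasDerivAt (fun t : ℝ => t • (ω : EE n)) (ω : EE n) t := by
      simpa using (hasDerivAt_id t).smul_const (ω : EE n)
    exact ((h.diff _).hasFDerivAt.comp_hasDerivAt t h1).mul_const _

theorem eul_fderiv (w : EE n → ℝ) (x) : eul w x = fderiv ℝ w x x := by
  rw [fderiv_eq_sum, eul]

theorem PP_eul (p : C(EE n, ℝ)) {w : EE n → ℝ} (h : Sm w) (r : ℝ) (hr : 0 < r) :
    HasDerivAt (PP p w) (PP p (eul w) r / r) r := by
  convert PP_deriv p h r using 1
  rw [div_eq_iff hr.ne', PP, ← integral_mul_const]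
  congr 1; ext ω
  rw [eul_fderiv, map_smul, smul_eq_mul]; ring

theorem PP_RF (p : C(EE n, ℝ)) {w : EE n → ℝ} (h : TF w) : RF (PP p w) := by
  refine ⟨continuous_iff_continuousAt.2 fun r => (PP_deriv p h.sm r).continuousAt, ?_⟩
  obtain ⟨ε, hε, h1⟩ := Metric.eventually_nhds_iff.1 h.ev
  obtain ⟨R, h2⟩ := h.cs.isBounded.subset_closedBall 0
  refine ⟨ε, hε, R, fun r hr hh => ?_⟩
  have nw : ∀ ω : SS n, ‖(ω : EE n)‖ = 1 := fun w => by simp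
  have : ∀ ω : SS n, w (r • (ω : EE n)) = 0 := by
    intro ω
    rcases hh with hh | hh
    · apply h1; simp [norm_smul, abs_of_nonneg hr, hh]
    · apply image_eq_zero_of_notMem_tsupport
      intro hm
      have := h2 hm
      simp [norm_smul, abs_of_nonneg hr] at this
      linarith
  simp [PP, this]

theorem PP_int (p : C(EE n, ℝ)) {w : EE n → ℝ} (h : Sm w) (r : ℝ) :
    Integrable (fun ω : SS n => w (r • (ω : EE n)) * p ω) (sig n) := by
  have cw := h.cont
  have cp := p.continuous
  exact (by fun_prop : Continuous (fun ω : SS n => w (r • (ω : EE n)) * p ω)).integrable_of_hasCompactSupport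
    (HasCompactSupport.of_compactSpace _)

theorem PP_add (p : C(EE n, ℝ)) {v w : EE n → ℝ} (hv : Sm v) (h : Sm w) (a : ℝ) (r : ℝ) :
    PP p (fun x => v x + a * w x) r = PP p v r + a * PP p w r := by
  simp only [PP]
  rw [← integral_const_mul, ← integral_add (PP_int p hv r) ((PP_int p h r).const_mul a)]
  congr 1; ext; ring

theorem PP_sph {k : ℕ} {p : C(EE n, ℝ)} (hp : p ∈ NN n (k + 1)) (ho : TT n p ∈ (WW n k)ᗮ)
    {w : EE n → ℝ} (h : Sm w) (r : ℝ) :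
    PP p (sph w) r = -((k:ℝ) * (k + n - 2)) * PP p w r := by
  simp only [PP]
  rw [← eigen hp ho (h.scale r)]
  simp_rw [sph_scale h]

theorem mode_step (p : C(EE n, ℝ)) {w : EE n → ℝ} (h : TF w) (m κ : ℝ) :
    (m - κ) ^ 2 * ∫ r in Set.Ioi (0:ℝ), r ^ (-2 * m - 1) * PP p w r ^ 2 ≤
      ∫ r in Set.Ioi (0:ℝ), r ^ (-2 * m - 1) * PP p (fun x => eul w x + (-κ) * w x) r ^ 2 := by
  have := oneD (PP_RF p h) (PP_RF p h.eul) (PP_eul p h.sm) m κ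
  simp_rw [PP_add p h.sm.eul h.sm]
  simpa [sub_eq_add_neg] using this

theorem mode_ineq (hn : 2 ≤ n) {k : ℕ} {p : C(EE n, ℝ)} (hp : p ∈ NN n (k + 1)) (ho : TT n p ∈ (WW n k)ᗮ)
    {u : EE n → ℝ} (h : TF u) (j : ℕ) :
    ((j:ℝ) + 1/2) ^ 2 / 4 * ∫ r in Set.Ioi (0:ℝ), r ^ (-2 * ((j:ℝ) + 1/2) - 1) * PP p u r ^ 2 ≤
      ∫ r in Set.Ioi (0:ℝ), r ^ (-2 * ((j:ℝ) + 1/2) - 1) * PP p (fun x => ‖x‖ ^ 2 * lap u x) r ^ 2 := by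
  set m : ℝ := (j:ℝ) + 1/2 with hm
  set l : ℝ := k + n - 2 with hl
  have hn' : (2:ℝ) ≤ n := by exact_mod_cast hn
  have tv : TF (fun x => eul u x + (-(-l)) * u x) := h.eul.add (TF.mul (sm_const _) h)
  have s1 := mode_step p h m (-l)
  have s2 := mode_step p tv m k
  have e : ∀ r, PP p (fun x => eul (fun x => eul u x + (-(-l)) * u x) x + (-(k:ℝ)) * (eul u x + (-(-l)) * u x)) r
      = PP p (fun x => ‖x‖ ^ 2 * lap u x) r := by
    intro r
    have e1 : (fun x => ‖x‖ ^ 2 * lap u x) = fun x => (eul (eul u) x + (n - 2) * eul u x) + 1 * sph u x := by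
      ext x; rw [sph_eq h.sm]; ring
    have e2 : eul (fun x => eul u x + (-(-l)) * u x) = fun x => eul (eul u) x + l * eul u x := by
      ext x
      have s : Sm (fun x => - -l * u x) := (sm_const _).mul h.sm
      simp only [eul]
      have := pd_add h.sm.eul s
      simp only [eul] at this
      simp only [this, pd_cmul h.sm, Finset.mul_sum, ← Finset.sum_add_distrib]
      exact Finset.sum_congr rfl fun i _ => by ring
    rw [e1, e2, PP_add p (h.sm.eul.eul.add ((sm_const _).mul h.sm.eul)) h.sm.sph, PP_sph hp ho h.sm,
      PP_add p (h.sm.eul.eul.add ((sm_const _).mul h.sm.eul)) (h.sm.eul.add ((sm_const _).mul h.sm)),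
      PP_add p h.sm.eul.eul h.sm.eul, PP_add p h.sm.eul.eul h.sm.eul, PP_add p h.sm.eul h.sm]
    rw [hl]; ring
  simp_rw [e] at s2
  refine le_trans ?_ s2
  refine le_trans ?_ (mul_le_mul_of_nonneg_left s1 (sq_nonneg _))
  rw [← mul_assoc]
  apply mul_le_mul_of_nonneg_right
  · have hk : (1:ℝ)/4 ≤ (m - k) ^ 2 := by
      have : (1:ℤ) ≤ (2 * (j - k) + 1) ^ 2 := by
        have : (2 * ((j:ℤ) - k) + 1) ≠ 0 := by omega
        have := sq_pos_of_ne_zero this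
        omega
      have : (1:ℝ) ≤ (2 * ((j:ℝ) - k) + 1) ^ 2 := by exact_mod_cast this
      rw [hm]; nlinarith
    have h2 : m ^ 2 ≤ (m - -l) ^ 2 := by
      have : 0 ≤ l := by rw [hl]; have : (0:ℝ) ≤ k := k.cast_nonneg; linarith
      have : 0 ≤ m := by positivity
      nlinarith
    calc m ^ 2 / 4 = (1/4) * m ^ 2 := by ring
      _ ≤ _ := mul_le_mul hk h2 (sq_nonneg _) (sq_nonneg _)
  · apply setIntegral_nonneg measurableSet_Ioi
    intro r hr
    exact mul_nonneg (Real.rpow_nonneg (le_of_lt hr) _) (sq_nonneg _)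

end
end Carl

namespace Carl
noncomputable section
variable {n : ℕ}

theorem polar (hn : 2 ≤ n) {f : EE n → ENNReal} (hf : Measurable f) :
    ∫⁻ x, f x = ∫⁻ r in Set.Ioi (0:ℝ), ENNReal.ofReal (r ^ (n - 1)) *
      ∫⁻ ω : SS n, f (r • (ω : EE n)) ∂(sig n) := by
  have : Nonempty (Fin n) := ⟨⟨0, by omega⟩⟩
  have hmp := (volume : Measure (EE n)).measurePreserving_homeomorphUnitSphereProd
  have hd : Module.finrank ℝ (EE n) = n := by simp
  rw [hd] at hmp
  have m1 : Measurable fun q : SS n × Set.Ioi (0:ℝ) => f ((q.2 : ℝ) • (q.1 : EE n)) := by fun_prop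
  have m2 : Measurable fun q : ℝ × SS n => f (q.1 • (q.2 : EE n)) := by fun_prop
  calc ∫⁻ x, f x = ∫⁻ x : ({0}ᶜ : Set (EE n)), f x ∂(volume.comap Subtype.val) := by
        rw [lintegral_subtype_comap (measurableSet_singleton _).compl f, restrict_compl_singleton]
    _ = ∫⁻ q : SS n × Set.Ioi (0:ℝ), f ((q.2 : ℝ) • (q.1 : EE n)) ∂((sig n).prod (Measure.volumeIoiPow (n - 1))) := by
        rw [← hmp.lintegral_comp m1]
        congr 1; ext x
        have : ((x : EE n)) ≠ 0 := x.2
        simp [smul_smul, this]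
    _ = ∫⁻ r : Set.Ioi (0:ℝ), ∫⁻ ω : SS n, f ((r : ℝ) • (ω : EE n)) ∂(sig n) ∂(Measure.volumeIoiPow (n - 1)) :=
        lintegral_prod_symm' _ m1
    _ = _ := by
        rw [Measure.volumeIoiPow, lintegral_withDensity_eq_lintegral_mul]
        · exact lintegral_subtype_comap measurableSet_Ioi (fun r : ℝ => ENNReal.ofReal (r ^ (n - 1)) *
            ∫⁻ ω : SS n, f (r • (ω : EE n)) ∂(sig n))
        · fun_prop
        · exact (m2.lintegral_prod_right').comp measurable_subtype_coe

theorem parseval {ι : Type} [Countable ι] (b : HilbertBasis ι ℝ (Lp ℝ 2 (sig n)))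
    (p : ι → C(EE n, ℝ)) (hb : ∀ i, b i = TT n (p i)) {w : EE n → ℝ} (h : Continuous w) (r : ℝ) :
    ∫⁻ ω : SS n, ENNReal.ofReal (w (r • (ω : EE n)) ^ 2) ∂(sig n) =
      ∑' i, ENNReal.ofReal (PP (p i) w r ^ 2) := by
  let W : C(EE n, ℝ) := ⟨fun x => w (r • x), by fun_prop⟩
  have hs := b.hasSum_inner_mul_inner (TT n W) (TT n W)
  have e : ∀ i, inner ℝ (TT n W) (b i) * inner ℝ (b i) (TT n W) = PP (p i) w r ^ 2 := by
    intro i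
    rw [real_inner_comm (TT n W), hb, inner_TT, pow_two]; rfl
  simp_rw [e, inner_TT] at hs
  rw [← ENNReal.ofReal_tsum_of_nonneg (fun i => sq_nonneg _) hs.summable, hs.tsum_eq,
    ofReal_integral_eq_lintegral_ofReal]
  · congr 1; ext ω; rw [pow_two]; rfl
  · have : Continuous fun ω : SS n => W ω * W ω := by fun_prop
    exact this.integrable_of_hasCompactSupport (HasCompactSupport.of_compactSpace _)
  · exact Filter.Eventually.of_forall fun ω => mul_self_nonneg _

theorem norm_sum (hn : 2 ≤ n) {ι : Type} [Countable ι] (b : HilbertBasis ι ℝ (Lp ℝ 2 (sig n)))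
    (p : ι → C(EE n, ℝ)) (hb : ∀ i, b i = TT n (p i)) {w : EE n → ℝ} (h : TF w) (m : ℝ) :
    ENNReal.ofReal (∫ x, ‖x‖ ^ (-2 * m - n) * w x ^ 2) =
      ∑' i, ENNReal.ofReal (∫ r in Set.Ioi (0:ℝ), r ^ (-2 * m - 1) * PP (p i) w r ^ 2) := by
  have cw := h.sm.cont
  rw [ofReal_integral_eq_lintegral_ofReal (h.int_sq _)
    (Filter.Eventually.of_forall fun x => mul_nonneg (Real.rpow_nonneg (norm_nonneg _) _) (sq_nonneg _))]
  have mw : Measurable w := cw.measurable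
  rw [polar hn (by fun_prop)]
  have e1 : ∀ r ∈ Set.Ioi (0:ℝ), ENNReal.ofReal (r ^ (n - 1)) *
      ∫⁻ ω : SS n, ENNReal.ofReal (‖r • (ω : EE n)‖ ^ (-2 * m - n) * w (r • (ω : EE n)) ^ 2) ∂(sig n)
      = ∑' i, ENNReal.ofReal (r ^ (-2 * m - 1) * PP (p i) w r ^ 2) := by
    intro r hr
    have hr : 0 < r := hr
    have nw : ∀ ω : SS n, ‖r • (ω : EE n)‖ = r := fun ω => by simp [norm_smul, abs_of_pos hr]
    simp_rw [nw, ENNReal.ofReal_mul (Real.rpow_nonneg hr.le _)]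
    rw [lintegral_const_mul _ (by fun_prop), parseval b p hb cw, ENNReal.tsum_mul_left, ← mul_assoc,
      ← ENNReal.ofReal_mul (by positivity)]
    congr 2
    rw [← Real.rpow_natCast, ← Real.rpow_add hr, Nat.cast_sub (by omega)]
    congr 1; push_cast; ring
  rw [setLIntegral_congr_fun measurableSet_Ioi e1, lintegral_tsum]
  · congr 1; ext i
    rw [ofReal_integral_eq_lintegral_ofReal]
    · have := (PP_RF (p i) h).int (PP_RF (p i) h).c (-2 * m - 1)
      simp only [pow_two]; exact this
    · filter_upwards [ae_restrict_mem measurableSet_Ioi] with r hr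
      exact mul_nonneg (Real.rpow_nonneg (le_of_lt hr) _) (sq_nonneg _)
  · intro i
    have : Measurable (PP (p i) w) := (PP_RF (p i) h).c.measurable
    fun_prop

theorem key (hn : 2 ≤ n) (u : EE n → ℝ) (h : TF u) (j : ℕ) :
    ((j:ℝ)+1/2)^2 * ∫ x, ‖x‖^(-2*((j:ℝ)+1/2) - n) * u x^2 ≤
      4 * ∫ x, ‖x‖^(-2*((j:ℝ)+1/2)+4-n) * lap u x^2 := by
  obtain ⟨ι, _, b, k, p, hp, hb, ho⟩ := exists_basis n
  have sn : Sm (fun x : EE n => ‖x‖ ^ 2) := contDiff_norm_sq ℝ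
  have tv : TF (fun x => ‖x‖ ^ 2 * lap u x) := TF.mul sn h.lap
  set m : ℝ := (j:ℝ) + 1/2 with hm
  have n1 := norm_sum hn b p hb h m
  have n2 := norm_sum hn b p hb tv m
  have e : ∫ x, ‖x‖^(-2*m+4-n) * lap u x^2 = ∫ x, ‖x‖ ^ (-2 * m - n) * (‖x‖ ^ 2 * lap u x) ^ 2 := by
    congr 1; ext x
    rcases eq_or_ne x 0 with rfl | hx
    · rw [h.lap.zero]; simp
    · have : 0 < ‖x‖ := norm_pos_iff.2 hx
      have e : ‖x‖^(-2*m+4-n) = ‖x‖ ^ (-2 * m - n) * ‖x‖ ^ 4 := by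
        rw [← Real.rpow_natCast ‖x‖ 4, ← Real.rpow_add this]; congr 1; push_cast; ring
      rw [e]; ring
  rw [e]
  have main : ENNReal.ofReal (m ^ 2 / 4 * ∫ x, ‖x‖ ^ (-2 * m - n) * u x ^ 2) ≤
      ENNReal.ofReal (∫ x, ‖x‖ ^ (-2 * m - n) * (‖x‖ ^ 2 * lap u x) ^ 2) := by
    rw [ENNReal.ofReal_mul (by positivity), n1, n2, ← ENNReal.tsum_mul_left]
    apply ENNReal.tsum_le_tsum
    intro i
    rw [← ENNReal.ofReal_mul (by positivity)]
    exact ENNReal.ofReal_le_ofReal (mode_ineq hn (hp i) (ho i) h j)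
  have := (ENNReal.ofReal_le_ofReal_iff (integral_nonneg fun x =>
    mul_nonneg (Real.rpow_nonneg (norm_nonneg _) _) (sq_nonneg _))).1 main
  linarith

end
end Carl

theorem carleman_polynomial_weight (n : ℕ) (hn : 2 ≤ n) :
    ∃ C : ℝ, 0 < C ∧
      ∀ u : EuclideanSpace ℝ (Fin n) → ℝ,
        ContDiff ℝ (⊤ : ℕ∞) u → HasCompactSupport u →
        (0 : EuclideanSpace ℝ (Fin n)) ∉ tsupport u →
        ∀ j : ℕ,
          (∑ k ∈ Finset.range 3,
            ((j : ℝ) + 1 / 2) ^ ((2 : ℝ) - 2 * k) *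
              ∫ x : EuclideanSpace ℝ (Fin n),
                ‖x‖ ^ (-2 * ((j : ℝ) + 1 / 2) + 2 * k - n) *
                  ‖iteratedFDeriv ℝ k u x‖ ^ 2) ≤
          C * ∫ x : EuclideanSpace ℝ (Fin n),
            ‖x‖ ^ (-2 * ((j : ℝ) + 1 / 2) + 4 - n) *
              (∑ i : Fin n, iteratedFDeriv ℝ 2 u x
                ![EuclideanSpace.single i 1, EuclideanSpace.single i 1]) ^ 2 := by
  exact Carl.final hn (Carl.key hn)
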